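/- arXiv:2305.00500 — 5 statements merged into one kernel-verified Lean document; each statement's English description precedes it below -/
import Mathlib

section
/- (Closed range theorem for relations.) Let X and Y be Banach spaces and let A ⊆ X × Y be a closed linear relation. Then ran A is closed in Y if and only if ran A' is closed in X'. -/
open Filter Topology

/-- Membership in the adjoint relation `A' ⊆ Y' × X'`:
`(y', x') ∈ A'` iff `x'(x) = y'(y)` for all `(x,y) ∈ A`. -/
def InAdjoint {𝕜 : Type*} [RCLike 𝕜]
    {X Y : Type*} [NormedAddCommGroup X] [NormedSpace 𝕜 X]
    [NormedAddCommGroup Y] [NormedSpace 𝕜 Y]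
    (A : Submodule 𝕜 (X × Y)) (y' : Y →L[𝕜] 𝕜) (x' : X →L[𝕜] 𝕜) : Prop :=
  ∀ p ∈ A, x' p.1 = y' p.2

/-- A continuous linear map from a Banach space is onto as soon as every `y` is approximated up to
`‖y‖ / 2` by the image of a vector of norm at most `C * ‖y‖`. -/
theorem ContinuousLinearMap.surjective_of_approx_preimage {𝕜 : Type*} [RCLike 𝕜]
    {E F : Type*} [NormedAddCommGroup E] [NormedSpace 𝕜 E] [CompleteSpace E]
    [NormedAddCommGroup F] [NormedSpace 𝕜 F] (T : E →L[𝕜] F) (C : ℝ) (hC : 0 ≤ C)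
    (h : ∀ y, ∃ x, ‖x‖ ≤ C * ‖y‖ ∧ ‖y - T x‖ ≤ 1 / 2 * ‖y‖) : Function.Surjective T := by
  intro y
  choose g hgC hg using h
  let r : ℕ → F := fun n ↦ (fun z ↦ z - T (g z))^[n] y
  have hr_succ (n : ℕ) : r (n + 1) = r n - T (g (r n)) := Function.iterate_succ_apply' _ _ _
  have hr (n : ℕ) : ‖r n‖ ≤ (1 / 2) ^ n * ‖y‖ := by
    induction n with
    | zero => simp [r]
    | succ n ih =>
      rw [hr_succ, pow_succ', mul_assoc]
      exact (hg _).trans (by gcongr)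
  have hsum : Summable fun n ↦ g (r n) := by
    refine .of_norm_bounded (g := fun n ↦ (1 / 2 : ℝ) ^ n * (C * ‖y‖))
      (summable_geometric_two.mul_right _) fun n ↦ (hgC _).trans ?_
    calc C * ‖r n‖ ≤ C * ((1 / 2) ^ n * ‖y‖) := by gcongr; exact hr n
      _ = _ := by ring
  have hpartial (n : ℕ) : T (∑ i ∈ Finset.range n, g (r i)) = y - r n := by
    induction n with
    | zero => simp [r]
    | succ n ih => rw [Finset.sum_range_succ, map_add, ih, hr_succ]; abel
  have hr_zero : Tendsto r atTop (𝓝 0) := by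
    refine squeeze_zero_norm hr ?_
    simpa using (tendsto_pow_atTop_nhds_zero_of_lt_one (r := (1 / 2 : ℝ))
      (by norm_num) (by norm_num)).mul_const ‖y‖
  have hlim := (T.continuous.tendsto _).comp hsum.hasSum.tendsto_sum_nat
  refine ⟨_, tendsto_nhds_unique hlim ?_⟩
  simpa [Function.comp_def, hpartial] using hr_zero.const_sub y

/-- If a closed relation between Banach spaces is injective and has closed range, then its inverse is
a bounded operator. -/
theorem Submodule.exists_norm_fst_le_of_isClosed_range {𝕜 : Type*} [RCLike 𝕜]
    {V W : Type*} [NormedAddCommGroup V] [NormedSpace 𝕜 V] [CompleteSpace V]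
    [NormedAddCommGroup W] [NormedSpace 𝕜 W] [CompleteSpace W]
    (S : Submodule 𝕜 (V × W)) (hS : IsClosed (S : Set (V × W)))
    (hinj : ∀ v, (v, 0) ∈ S → v = 0) (hran : IsClosed {w : W | ∃ v, (v, w) ∈ S}) :
    ∃ C : ℝ, 0 ≤ C ∧ ∀ v w, (v, w) ∈ S → ‖v‖ ≤ C * ‖w‖ := by
  have := hS.completeSpace_coe
  let P : S →L[𝕜] W := (ContinuousLinearMap.snd 𝕜 V W).comp S.subtypeL
  have hP : Function.Injective P := by
    refine (injective_iff_map_eq_zero P).2 fun ⟨⟨v, w⟩, hq⟩ hw ↦ ?_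
    obtain rfl : w = 0 := hw
    obtain rfl := hinj v hq
    rfl
  have hrange : Set.range P = {w | ∃ v, (v, w) ∈ S} := by
    ext w
    constructor
    · rintro ⟨⟨⟨v, w⟩, hq⟩, rfl⟩
      exact ⟨v, hq⟩
    · rintro ⟨v, hv⟩
      exact ⟨⟨(v, w), hv⟩, rfl⟩
  obtain ⟨K, hK⟩ := P.antilipschitz_of_injective_of_isClosed_range hP (hrange ▸ hran)
  refine ⟨K, K.2, fun v w h ↦ ?_⟩
  calc ‖v‖ ≤ ‖(⟨(v, w), h⟩ : S)‖ := norm_fst_le (v, w)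
    _ ≤ K * ‖w‖ := ZeroHomClass.bound_of_antilipschitz P hK _

section Relation

variable {𝕜 : Type*} [RCLike 𝕜] {X Y : Type*} [NormedAddCommGroup X] [NormedSpace 𝕜 X]
  [NormedAddCommGroup Y] [NormedSpace 𝕜 Y] (A : Submodule 𝕜 (X × Y))

/-- The adjoint of a relation, as a subspace of the product of the dual spaces. -/
def adjointSubmodule : Submodule 𝕜 ((Y →L[𝕜] 𝕜) × (X →L[𝕜] 𝕜)) where
  carrier := {q | InAdjoint A q.1 q.2}
  add_mem' := fun h₁ h₂ p hp ↦ by simp [h₁ p hp, h₂ p hp]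
  zero_mem' := fun p _ ↦ by simp
  smul_mem' := fun c q h p hp ↦ by simp [h p hp]

theorem mem_adjointSubmodule {q : (Y →L[𝕜] 𝕜) × (X →L[𝕜] 𝕜)} :
    q ∈ adjointSubmodule A ↔ InAdjoint A q.1 q.2 := Iff.rfl

theorem isClosed_adjointSubmodule :
    IsClosed (adjointSubmodule A : Set ((Y →L[𝕜] 𝕜) × (X →L[𝕜] 𝕜))) := by
  have : (adjointSubmodule A : Set ((Y →L[𝕜] 𝕜) × (X →L[𝕜] 𝕜))) =
      ⋂ p ∈ A, {q | q.2 p.1 = q.1 p.2} := by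
    ext q
    simp [mem_adjointSubmodule, InAdjoint]
  rw [this]
  refine isClosed_biInter fun p _ ↦ isClosed_eq ?_ ?_
  · exact (ContinuousLinearMap.apply 𝕜 𝕜 p.1).continuous.comp continuous_snd
  · exact (ContinuousLinearMap.apply 𝕜 𝕜 p.2).continuous.comp continuous_fst

/-- If the range of `A` is dense and that of its adjoint is closed, then the inverse of the adjoint
is a bounded operator. -/
theorem exists_norm_le_of_isClosed_range_adjoint (hdense : Dense {y : Y | ∃ x, (x, y) ∈ A})
    (hclosed : IsClosed {x' : X →L[𝕜] 𝕜 | ∃ y' : Y →L[𝕜] 𝕜, InAdjoint A y' x'}) :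
    ∃ C : ℝ, 0 ≤ C ∧ ∀ (y' : Y →L[𝕜] 𝕜) (x' : X →L[𝕜] 𝕜), InAdjoint A y' x' →
      ‖y'‖ ≤ C * ‖x'‖ := by
  refine (adjointSubmodule A).exists_norm_fst_le_of_isClosed_range
    (isClosed_adjointSubmodule A) (fun y' hy' ↦ ?_) hclosed
  refine DFunLike.coe_injective
    (Continuous.ext_on hdense y'.continuous (0 : Y →L[𝕜] 𝕜).continuous ?_)
  rintro y ⟨x, hxy⟩
  exact (hy' _ hxy).symm

/-- A bound on the inverse of the adjoint yields approximate preimages under the relation. -/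
theorem exists_approx_mem_of_adjoint_bound {C : ℝ} (hC : 0 ≤ C)
    (hbound : ∀ (y' : Y →L[𝕜] 𝕜) (x' : X →L[𝕜] 𝕜), InAdjoint A y' x' → ‖y'‖ ≤ C * ‖x'‖) (y : Y) :
    ∃ p ∈ A, ‖p‖ ≤ (C + 2) * ‖y‖ ∧ ‖y - p.2‖ ≤ 1 / 2 * ‖y‖ := by
  rcases eq_or_ne y 0 with rfl | hy
  · exact ⟨0, A.zero_mem, by simp⟩
  have hy0 : 0 < ‖y‖ := norm_pos_iff.2 hy
  -- rescaling the second coordinate by `k` makes the distance to the relation favour it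
  let k : ℝ := 2 * (C + 1)
  have hk : 0 < k := by positivity
  have hk' : (k : 𝕜) ≠ 0 := by exact_mod_cast hk.ne'
  let Φ : X × Y →ₗ[𝕜] X × Y := LinearMap.prodMap LinearMap.id ((k : 𝕜) • LinearMap.id)
  let B : Submodule 𝕜 (X × Y) := A.map Φ
  let v : (X × Y) ⧸ B := Submodule.Quotient.mk (0, (k : 𝕜) • y)
  obtain ⟨g, hg, hgv⟩ := exists_dual_vector'' 𝕜 v
  let φ : X × Y →L[𝕜] 𝕜 := LinearMap.mkContinuous (g.toLinearMap ∘ₗ B.mkQ) 1 fun z ↦ by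
    refine (g.le_of_opNorm_le hg _).trans ?_
    gcongr
    exact Submodule.Quotient.norm_mk_le B z
  have hφ : ‖φ‖ ≤ 1 := LinearMap.mkContinuous_norm_le _ zero_le_one _
  have hφB (z) (hz : z ∈ B) : φ z = 0 := by
    change g (Submodule.Quotient.mk z) = 0
    rw [(Submodule.Quotient.mk_eq_zero B).2 hz, map_zero]
  let x' : X →L[𝕜] 𝕜 := φ.comp (ContinuousLinearMap.inl 𝕜 X Y)
  let y' : Y →L[𝕜] 𝕜 := φ.comp (ContinuousLinearMap.inr 𝕜 X Y)
  have hx' : ‖x'‖ ≤ 1 := by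
    refine ContinuousLinearMap.opNorm_le_bound _ zero_le_one fun x ↦ ?_
    simpa [x'] using φ.le_of_opNorm_le hφ (x, 0)
  have hadj : InAdjoint A (-((k : 𝕜) • y')) x' := by
    intro p hp
    have h := hφB _ (Submodule.mem_map_of_mem (f := Φ) hp)
    have hsplit : Φ p = (p.1, 0) + (k : 𝕜) • (0, p.2) := by simp [Φ]
    rw [hsplit, map_add, map_smul] at h
    simpa [x', y'] using eq_neg_of_add_eq_zero_left h
  have hy' : ‖(k : 𝕜) • y'‖ ≤ C := by
    rw [← norm_neg]
    exact (hbound _ _ hadj).trans (mul_le_of_le_one_right hC hx')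
  have hv : ‖v‖ ≤ C * ‖y‖ := by
    have h : ((‖v‖ : ℝ) : 𝕜) = ((k : 𝕜) • y') y := by
      rw [← hgv, smul_apply, ← map_smul]
      rfl
    have := ContinuousLinearMap.le_of_opNorm_le _ hy' y
    rwa [← h, RCLike.norm_ofReal, abs_norm] at this
  obtain ⟨z, hzv, hz⟩ := Submodule.Quotient.norm_mk_lt v hy0
  obtain ⟨p, hp, hpz⟩ := (Submodule.Quotient.eq B).1 hzv.symm
  have hz' : ‖z‖ ≤ (C + 1) * ‖y‖ := by linarith
  obtain rfl : z = (-p.1, (k : 𝕜) • (y - p.2)) := by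
    rw [← sub_eq_iff_eq_add.2 (eq_add_of_sub_eq' hpz.symm)]
    simp [Φ, smul_sub]
  have h1 : ‖p.1‖ ≤ (C + 1) * ‖y‖ := by simpa using (norm_fst_le _).trans hz'
  have h2 : ‖y - p.2‖ ≤ 1 / 2 * ‖y‖ := by
    have := (norm_snd_le _).trans hz'
    rw [norm_smul, RCLike.norm_ofReal, abs_of_pos hk] at this
    refine le_of_mul_le_mul_left ?_ hk
    calc _ ≤ _ := this
      _ = _ := by simp only [k]; ring
  refine ⟨p, hp, ?_, h2⟩
  have h3 : ‖p.2‖ ≤ ‖y‖ + ‖y - p.2‖ := by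
    simpa using norm_sub_le y (y - p.2)
  rw [Prod.norm_def]
  refine max_le ?_ ?_ <;> nlinarith

/-- A closed relation with dense range whose adjoint has closed range is onto. -/
theorem exists_mem_of_isClosed_range_adjoint [CompleteSpace X] [CompleteSpace Y]
    (hA : IsClosed (A : Set (X × Y))) (hdense : Dense {y : Y | ∃ x, (x, y) ∈ A})
    (hclosed : IsClosed {x' : X →L[𝕜] 𝕜 | ∃ y' : Y →L[𝕜] 𝕜, InAdjoint A y' x'}) (y : Y) :
    ∃ x, (x, y) ∈ A := by
  obtain ⟨C, hC, hbound⟩ := exists_norm_le_of_isClosed_range_adjoint A hdense hclosed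
  have := hA.completeSpace_coe
  let T : A →L[𝕜] Y := (ContinuousLinearMap.snd 𝕜 X Y).comp A.subtypeL
  have hT : Function.Surjective T := by
    refine T.surjective_of_approx_preimage (C + 2) (by positivity) fun y ↦ ?_
    obtain ⟨p, hp, h⟩ := exists_approx_mem_of_adjoint_bound A hC hbound y
    exact ⟨⟨p, hp⟩, h⟩
  obtain ⟨⟨⟨x, _⟩, hp⟩, rfl⟩ := hT y
  exact ⟨x, hp⟩

/-- The range of a closed relation is closed if that of its adjoint is. -/
theorem isClosed_range_of_isClosed_range_adjoint [CompleteSpace X] [CompleteSpace Y]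
    (hA : IsClosed (A : Set (X × Y)))
    (hclosed : IsClosed {x' : X →L[𝕜] 𝕜 | ∃ y' : Y →L[𝕜] 𝕜, InAdjoint A y' x'}) :
    IsClosed {y : Y | ∃ x, (x, y) ∈ A} := by
  let R : Submodule 𝕜 Y := (A.map (LinearMap.snd 𝕜 X Y)).topologicalClosure
  have hAR (p) (hp : p ∈ A) : p.2 ∈ R :=
    Submodule.le_topologicalClosure _ (Submodule.mem_map_of_mem hp)
  have hR : IsClosed (R : Set Y) := Submodule.isClosed_topologicalClosure _
  have := hR.completeSpace_coe
  let ι : X × R →L[𝕜] X × Y := (ContinuousLinearMap.id 𝕜 X).prodMap R.subtypeL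
  let B : Submodule 𝕜 (X × R) := A.comap ι.toLinearMap
  have hB : IsClosed (B : Set (X × R)) := hA.preimage ι.continuous
  have hadj : {x' : X →L[𝕜] 𝕜 | ∃ y' : R →L[𝕜] 𝕜, InAdjoint B y' x'} =
      {x' | ∃ y' : Y →L[𝕜] 𝕜, InAdjoint A y' x'} := by
    ext x'
    constructor
    · rintro ⟨f, hf⟩
      obtain ⟨y', hy', -⟩ := exists_extension_norm_eq R f
      refine ⟨y', fun p hp ↦ ?_⟩
      rw [hf (p.1, ⟨p.2, hAR p hp⟩) hp]
      exact (hy' ⟨p.2, hAR p hp⟩).symm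
    · rintro ⟨y', hy'⟩
      exact ⟨y'.comp R.subtypeL, fun p hp ↦ hy' _ hp⟩
  have hdense : Dense {y : R | ∃ x, (x, y) ∈ B} := by
    intro y
    rw [closure_subtype]
    refine Iff.mpr (iff_of_eq ?_) y.2
    change _ = ((y : Y) ∈ closure ((A.map (LinearMap.snd 𝕜 X Y) : Submodule 𝕜 Y) : Set Y))
    congr 2
    ext z
    constructor
    · rintro ⟨w, ⟨x, hx⟩, rfl⟩
      exact ⟨_, hx, rfl⟩
    · rintro ⟨p, hp, rfl⟩
      exact ⟨⟨p.2, hAR p hp⟩, ⟨p.1, hp⟩, rfl⟩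
  have hsurj := exists_mem_of_isClosed_range_adjoint B hB hdense (hadj ▸ hclosed)
  convert hR using 1
  ext y
  exact ⟨fun ⟨x, hx⟩ ↦ hAR _ hx, fun hy ↦ hsurj ⟨y, hy⟩⟩

/-- If a closed relation has closed range, the range of its adjoint is the annihilator of its
kernel. -/
theorem range_adjoint_eq_of_isClosed_range [CompleteSpace X] [CompleteSpace Y]
    (hA : IsClosed (A : Set (X × Y))) (hran : IsClosed {y : Y | ∃ x, (x, y) ∈ A}) :
    {x' : X →L[𝕜] 𝕜 | ∃ y' : Y →L[𝕜] 𝕜, InAdjoint A y' x'} =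
      {x' | ∀ x, (x, 0) ∈ A → x' x = 0} := by
  ext x'
  refine ⟨fun ⟨y', hy'⟩ x hx ↦ by simpa using hy' _ hx, fun hx' ↦ ?_⟩
  let R : Submodule 𝕜 Y := A.map (LinearMap.snd 𝕜 X Y)
  have hR : IsClosed (R : Set Y) := by
    convert hran using 1
    ext y
    simp [R]
  have := hR.completeSpace_coe
  have := hA.completeSpace_coe
  let T : A →L[𝕜] R := ((ContinuousLinearMap.snd 𝕜 X Y).comp A.subtypeL).codRestrict R
    fun p ↦ Submodule.mem_map_of_mem p.2
  have hT : Function.Surjective T := by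
    rintro ⟨_, p, hp, rfl⟩
    exact ⟨⟨p, hp⟩, rfl⟩
  obtain ⟨C, -, hC⟩ := T.exists_preimage_norm_le hT
  choose g hgT hg using hC
  have hker (p q : A) (h : T p = T q) : x' p.1.1 = x' q.1.1 := by
    rw [← sub_eq_zero, ← map_sub]
    refine hx' _ ?_
    have h0 : (p.1 - q.1).2 = 0 := sub_eq_zero.2 (congrArg Subtype.val h)
    have hmem := A.sub_mem p.2 q.2
    rwa [← Prod.mk.eta (p := p.1 - q.1), h0] at hmem
  let f₀ : R →ₗ[𝕜] 𝕜 :=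
    { toFun y := x' (g y).1.1
      map_add' y z := by
        rw [hker (g (y + z)) (g y + g z) (by simp [hgT])]
        simp
      map_smul' c y := by
        rw [hker (g (c • y)) (c • g y) (by simp [hgT])]
        simp }
  let f : R →L[𝕜] 𝕜 := f₀.mkContinuous (‖x'‖ * C) fun y ↦ by
    calc ‖x' (g y).1.1‖ ≤ ‖x'‖ * ‖(g y).1.1‖ := x'.le_opNorm _
      _ ≤ ‖x'‖ * (C * ‖y‖) := by
        gcongr
        exact (norm_fst_le (g y).1).trans (hg y)
      _ = ‖x'‖ * C * ‖y‖ := by ring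
  obtain ⟨y', hy', -⟩ := exists_extension_norm_eq R f
  refine ⟨y', fun p hp ↦ ?_⟩
  exact (hker ⟨p, hp⟩ (g (T ⟨p, hp⟩)) (hgT _).symm).trans (hy' (T ⟨p, hp⟩)).symm

/-- The range of the adjoint of a closed relation with closed range is closed. -/
theorem isClosed_range_adjoint_of_isClosed_range [CompleteSpace X] [CompleteSpace Y]
    (hA : IsClosed (A : Set (X × Y))) (hran : IsClosed {y : Y | ∃ x, (x, y) ∈ A}) :
    IsClosed {x' : X →L[𝕜] 𝕜 | ∃ y' : Y →L[𝕜] 𝕜, InAdjoint A y' x'} := by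
  rw [range_adjoint_eq_of_isClosed_range A hA hran]
  simp only [Set.ofPred_forall]
  exact isClosed_iInter fun x ↦ isClosed_iInter fun _ ↦
    isClosed_eq (ContinuousLinearMap.apply 𝕜 𝕜 x).continuous continuous_const

end Relation

/-- Closed range theorem for relations: for a closed relation `A ⊆ X × Y`,
`ran A` is closed in `Y` iff `ran A'` is closed in `X'`. -/
theorem stmt_2 {𝕜 : Type*} [RCLike 𝕜]
    {X Y : Type*} [NormedAddCommGroup X] [NormedSpace 𝕜 X] [CompleteSpace X]
    [NormedAddCommGroup Y] [NormedSpace 𝕜 Y] [CompleteSpace Y]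
    (A : Submodule 𝕜 (X × Y)) (hA : IsClosed (A : Set (X × Y))) :
    IsClosed {y : Y | ∃ x, (x, y) ∈ A} ↔
      IsClosed {x' : X →L[𝕜] 𝕜 | ∃ y' : Y →L[𝕜] 𝕜, InAdjoint A y' x'} := by
  exact ⟨isClosed_range_adjoint_of_isClosed_range A hA,
    isClosed_range_of_isClosed_range_adjoint A hA⟩
end

section
/- Let X and Y be Banach spaces and let A ⊆ X × Y be a closed linear relation. The following assertions are equivalent: (i) ran A = Y; (ii) there exists α > 0 such that α‖y'‖ ≤ ‖x'‖ for all (y',x') ∈ A'; (iii) ker A' = {0} and ran A' is closed in X'. -/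
open Filter Topology

namespace ContinuousLinearMap

variable {𝕜 E F : Type*} [RCLike 𝕜] [NormedAddCommGroup E] [NormedSpace 𝕜 E]
  [NormedAddCommGroup F] [NormedSpace 𝕜 F]

/-- A functional whose real part is bounded by `u` on the open unit ball has norm at most `u`. -/
theorem norm_le_of_forall_mem_ball_re_le (φ : E →L[𝕜] 𝕜) {u : ℝ}
    (h : ∀ p ∈ Metric.ball (0 : E) 1, RCLike.re (φ p) ≤ u) : ‖φ‖ ≤ u := by
  rw [← φ.sSup_unit_ball_eq_norm]
  refine csSup_le ((Metric.nonempty_ball.2 one_pos).image _) ?_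
  rintro _ ⟨p, hp, rfl⟩
  obtain ⟨c, hc, hcp⟩ := RCLike.exists_norm_eq_mul_self (φ p)
  have := h (c • p) (by simpa [norm_smul, hc] using hp)
  rwa [map_smul, smul_eq_mul, ← hcp, RCLike.ofReal_re] at this

/-- If the dual of `f` is bounded below by `c`, the closure of the image of the open unit ball
contains the closed ball of radius `c`. -/
theorem closedBall_subset_closure_image_ball (f : E →L[𝕜] F) {c : ℝ}
    (h : ∀ g : F →L[𝕜] 𝕜, c * ‖g‖ ≤ ‖g.comp f‖) :
    Metric.closedBall (0 : F) c ⊆ closure (f '' Metric.ball 0 1) := by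
  let _ : NormedSpace ℝ E := NormedSpace.restrictScalars ℝ 𝕜 E
  let _ : NormedSpace ℝ F := NormedSpace.restrictScalars ℝ 𝕜 F
  have : IsScalarTower ℝ 𝕜 E := RestrictScalars.isScalarTower ℝ 𝕜 E
  have : IsScalarTower ℝ 𝕜 F := RestrictScalars.isScalarTower ℝ 𝕜 F
  intro y hy
  by_contra hy'
  have hconv : Convex ℝ (closure (f '' Metric.ball 0 1)) :=
    ((convex_ball (0 : E) 1).linear_image (f.restrictScalars ℝ).toLinearMap).closure
  obtain ⟨g, u, hg, hgy⟩ :=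
    RCLike.geometric_hahn_banach_closed_point (𝕜 := 𝕜) hconv isClosed_closure hy'
  have hu : ‖g.comp f‖ ≤ u := norm_le_of_forall_mem_ball_re_le _ fun p hp =>
    (hg _ (subset_closure ⟨p, hp, rfl⟩)).le
  have : RCLike.re (g y) ≤ c * ‖g‖ := calc
    RCLike.re (g y) ≤ ‖g y‖ := RCLike.re_le_norm _
    _ ≤ ‖g‖ * ‖y‖ := g.le_opNorm y
    _ ≤ ‖g‖ * c := by gcongr; simpa using hy
    _ = c * ‖g‖ := mul_comm _ _
  linarith [h g]

/-- A continuous linear map from a Banach space is surjective as soon as every point of the target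
is approximated, up to half its norm, by the image of a point of controlled norm. -/
theorem surjective_of_exists_approx_preimage_norm_le [CompleteSpace E] (f : E →L[𝕜] F) {C : ℝ}
    (hC : 0 ≤ C) (h : ∀ y, ∃ x, ‖y - f x‖ ≤ 1 / 2 * ‖y‖ ∧ ‖x‖ ≤ C * ‖y‖) :
    Function.Surjective f := by
  choose g hg hgC using h
  intro y
  let r : ℕ → F := fun n => (fun z => z - f (g z))^[n] y
  have hr_succ (n : ℕ) : r (n + 1) = r n - f (g (r n)) := Function.iterate_succ_apply' _ _ _
  have hr (n : ℕ) : ‖r n‖ ≤ ‖y‖ * (1 / 2) ^ n := by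
    induction n with
    | zero => simp [r]
    | succ n ih =>
      rw [hr_succ, pow_succ]
      linarith [hg (r n)]
  have hsum : Summable fun n => g (r n) := by
    refine .of_norm_bounded (g := fun n => C * (‖y‖ * (1 / 2) ^ n))
      ((summable_geometric_two.mul_left _).mul_left _) fun n => (hgC _).trans ?_
    gcongr
    exact hr n
  have hpartial (n : ℕ) : f (∑ i ∈ Finset.range n, g (r i)) = y - r n := by
    induction n with
    | zero => simp [r]
    | succ n ih => rw [Finset.sum_range_succ, map_add, ih, hr_succ]; abel
  have hr_zero : Tendsto r atTop (𝓝 0) := by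
    refine squeeze_zero_norm hr ?_
    simpa using (tendsto_pow_atTop_nhds_zero_of_lt_one (r := (1 / 2 : ℝ))
      (by norm_num) (by norm_num)).const_mul ‖y‖
  have hlim := (f.continuous.tendsto _).comp hsum.hasSum.tendsto_sum_nat
  refine ⟨∑' n, g (r n), tendsto_nhds_unique hlim ?_⟩
  simpa [Function.comp_def, hpartial] using hr_zero.const_sub y

/-- A continuous linear map from a Banach space whose dual is bounded below is surjective. -/
theorem surjective_of_le_norm_comp [CompleteSpace E] (f : E →L[𝕜] F) {c : ℝ} (hc : 0 < c)
    (h : ∀ g : F →L[𝕜] 𝕜, c * ‖g‖ ≤ ‖g.comp f‖) : Function.Surjective f := by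
  refine f.surjective_of_exists_approx_preimage_norm_le (C := c⁻¹) (by positivity) fun y => ?_
  rcases eq_or_ne y 0 with rfl | hy
  · exact ⟨0, by simp⟩
  have hy0 : 0 < ‖y‖ := norm_pos_iff.2 hy
  let a : 𝕜 := ((‖y‖ / c : ℝ) : 𝕜)
  have ha : ‖a‖ = ‖y‖ / c := by simp [a, abs_of_pos hc]
  have ha0 : a ≠ 0 := norm_pos_iff.1 (ha ▸ by positivity)
  have hmem : a⁻¹ • y ∈ Metric.closedBall (0 : F) c := by
    rw [mem_closedBall_zero_iff, norm_smul, norm_inv, ha]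
    field_simp
    exact le_rfl
  obtain ⟨_, ⟨p, hp, rfl⟩, hdist⟩ := Metric.mem_closure_iff.1
    (f.closedBall_subset_closure_image_ball h hmem) (c / 2) (by positivity)
  rw [dist_eq_norm] at hdist
  rw [mem_ball_zero_iff] at hp
  refine ⟨a • p, ?_, ?_⟩
  · have : y - f (a • p) = a • (a⁻¹ • y - f p) := by rw [smul_sub, smul_inv_smul₀ ha0, map_smul]
    calc ‖y - f (a • p)‖ = ‖y‖ / c * ‖a⁻¹ • y - f p‖ := by rw [this, norm_smul, ha]
      _ ≤ ‖y‖ / c * (c / 2) := by gcongr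
      _ = 1 / 2 * ‖y‖ := by field_simp
  · calc ‖a • p‖ = ‖y‖ / c * ‖p‖ := by rw [norm_smul, ha]
      _ ≤ ‖y‖ / c * 1 := by gcongr
      _ = c⁻¹ * ‖y‖ := by ring

end ContinuousLinearMap

section Relation

variable {𝕜 X Y : Type*} [RCLike 𝕜] [NormedAddCommGroup X] [NormedSpace 𝕜 X]
  [NormedAddCommGroup Y] [NormedSpace 𝕜 Y] (A : Submodule 𝕜 (X × Y))

/-- The adjoint of a linear relation, as a subspace of the product of the dual spaces. -/
def adjointRelation : Submodule 𝕜 ((Y →L[𝕜] 𝕜) × (X →L[𝕜] 𝕜)) where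
  carrier := {q | InAdjoint A q.1 q.2}
  zero_mem' p _ := by simp
  add_mem' h₁ h₂ p hp := by simp [h₁ p hp, h₂ p hp]
  smul_mem' a _ h p hp := by simp [h p hp]

theorem isClosed_adjointRelation :
    IsClosed (adjointRelation A : Set ((Y →L[𝕜] 𝕜) × (X →L[𝕜] 𝕜))) := by
  have : (adjointRelation A : Set ((Y →L[𝕜] 𝕜) × (X →L[𝕜] 𝕜))) =
      ⋂ p ∈ A, {q | q.2 p.1 = q.1 p.2} := by
    ext q
    simp [adjointRelation, InAdjoint]
  rw [this]
  refine isClosed_biInter fun p _ => isClosed_eq ?_ ?_ <;> fun_prop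

/-- The projection of the adjoint relation to the dual of the first factor. -/
def adjointRelationSnd : adjointRelation A →L[𝕜] (X →L[𝕜] 𝕜) :=
  (ContinuousLinearMap.snd 𝕜 _ _).comp (adjointRelation A).subtypeL

theorem range_adjointRelationSnd :
    Set.range (adjointRelationSnd A) = {x' | ∃ y', InAdjoint A y' x'} := by
  ext x'
  exact ⟨fun ⟨q, hq⟩ => ⟨q.1.1, hq ▸ q.2⟩, fun ⟨y', h⟩ => ⟨⟨(y', x'), h⟩, rfl⟩⟩

variable {A}

theorem injective_adjointRelationSnd_iff :
    Function.Injective (adjointRelationSnd A) ↔ ∀ y', InAdjoint A y' 0 → y' = 0 := by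
  rw [injective_iff_map_eq_zero]
  refine ⟨fun h y' hy' => ?_, fun h q hq => ?_⟩
  · exact congrArg (fun q => q.1.1) (h ⟨(y', 0), hy'⟩ rfl)
  · have hq' : q.1.2 = 0 := hq
    have : q.1.1 = 0 := h _ (hq' ▸ q.2)
    exact Subtype.ext (Prod.ext this hq')

theorem exists_antilipschitzWith_adjointRelationSnd_iff :
    (∃ K, AntilipschitzWith K (adjointRelationSnd A)) ↔
      ∃ α : ℝ, 0 < α ∧ ∀ y' x', InAdjoint A y' x' → α * ‖y'‖ ≤ ‖x'‖ := by
  constructor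
  · rintro ⟨K, hK⟩
    refine ⟨(K + 1 : ℝ)⁻¹, by positivity, fun y' x' h => ?_⟩
    rw [inv_mul_le_iff₀ (by positivity)]
    have hb : ‖(y', x')‖ ≤ K * ‖x'‖ :=
      hK.le_mul_norm (map_zero _) (⟨(y', x'), h⟩ : adjointRelation A)
    linarith [norm_fst_le (y', x'), norm_nonneg x']
  · rintro ⟨α, hα, h⟩
    refine ⟨⟨α⁻¹ + 1, by positivity⟩,
      AddMonoidHomClass.antilipschitz_of_bound (adjointRelationSnd A) fun q => ?_⟩
    have hq := h _ _ q.2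
    change max ‖q.1.1‖ ‖q.1.2‖ ≤ (α⁻¹ + 1) * ‖q.1.2‖
    rw [mul_comm, ← le_div_iff₀ hα] at hq
    have : 0 ≤ α⁻¹ * ‖q.1.2‖ := by positivity
    refine max_le ?_ ?_
    · rw [div_eq_inv_mul] at hq
      linarith [norm_nonneg q.1.2]
    · linarith

variable (A) in
/-- The projection of a linear relation to `Y`. -/
def relationSnd : A →L[𝕜] Y := (ContinuousLinearMap.snd 𝕜 X Y).comp A.subtypeL

theorem surjective_relationSnd_iff :
    Function.Surjective (relationSnd A) ↔ ∀ y, ∃ x, (x, y) ∈ A :=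
  forall_congr' fun _ => ⟨fun ⟨p, hp⟩ => ⟨p.1.1, hp ▸ p.2⟩, fun ⟨x, h⟩ => ⟨⟨(x, _), h⟩, rfl⟩⟩

theorem le_norm_comp_relationSnd {α : ℝ} (hα : 0 < α)
    (h : ∀ y' x', InAdjoint A y' x' → α * ‖y'‖ ≤ ‖x'‖) (g : Y →L[𝕜] 𝕜) :
    α / (1 + α) * ‖g‖ ≤ ‖g.comp (relationSnd A)‖ := by
  obtain ⟨ψ, hψ, hnorm⟩ := exists_extension_norm_eq A (g.comp (relationSnd A))
  let x' : X →L[𝕜] 𝕜 := ψ.comp (.inl 𝕜 X Y)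
  let w' : Y →L[𝕜] 𝕜 := ψ.comp (.inr 𝕜 X Y)
  have hx' : ‖x'‖ ≤ ‖ψ‖ := x'.opNorm_le_bound (norm_nonneg _) fun x => by
    simpa [x'] using ψ.le_opNorm (x, 0)
  have hw' : ‖w'‖ ≤ ‖ψ‖ := w'.opNorm_le_bound (norm_nonneg _) fun y => by
    simpa [w'] using ψ.le_opNorm (0, y)
  have hadj : InAdjoint A (g - w') x' := fun p hp => by
    have hp' : ψ p = g p.2 := hψ ⟨p, hp⟩
    have : x' p.1 + w' p.2 = ψ p := by simp [x', w', ← map_add]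
    rw [sub_apply, ← hp', ← this, add_sub_cancel_right]
  rw [← hnorm, div_mul_eq_mul_div, div_le_iff₀ (by positivity)]
  calc α * ‖g‖ ≤ α * (‖g - w'‖ + ‖w'‖) := by gcongr; exact norm_le_norm_sub_add g w'
    _ = α * ‖g - w'‖ + α * ‖w'‖ := mul_add _ _ _
    _ ≤ ‖ψ‖ + α * ‖ψ‖ := by gcongr; exact (h _ _ hadj).trans hx'
    _ = ‖ψ‖ * (1 + α) := by ring

end Relation

/-- For a closed relation `A ⊆ X × Y` the following are equivalent:
(i) `ran A = Y`; (ii) `∃ α > 0, α‖y'‖ ≤ ‖x'‖ for all (y',x') ∈ A'`;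
(iii) `ker A' = {0}` and `ran A'` is closed in `X'`. -/
theorem stmt_3 {𝕜 : Type*} [RCLike 𝕜]
    {X Y : Type*} [NormedAddCommGroup X] [NormedSpace 𝕜 X] [CompleteSpace X]
    [NormedAddCommGroup Y] [NormedSpace 𝕜 Y] [CompleteSpace Y]
    (A : Submodule 𝕜 (X × Y)) (hA : IsClosed (A : Set (X × Y))) :
    List.TFAE
      [ -- (i) ran A = Y
        ∀ y : Y, ∃ x, (x, y) ∈ A,
        -- (ii) ∃ α > 0, α‖y'‖ ≤ ‖x'‖ for all (y',x') ∈ A'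
        ∃ α : ℝ, 0 < α ∧ ∀ (y' : Y →L[𝕜] 𝕜) (x' : X →L[𝕜] 𝕜),
          InAdjoint A y' x' → α * ‖y'‖ ≤ ‖x'‖,
        -- (iii) ker A' = {0} and ran A' is closed
        (∀ y' : Y →L[𝕜] 𝕜, InAdjoint A y' (0 : X →L[𝕜] 𝕜) → y' = 0) ∧
          IsClosed {x' : X →L[𝕜] 𝕜 | ∃ y' : Y →L[𝕜] 𝕜, InAdjoint A y' x'} ] := by
  have : CompleteSpace A := hA.completeSpace_coe
  have : CompleteSpace (adjointRelation A) := (isClosed_adjointRelation A).completeSpace_coe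
  tfae_have 1 → 2 := by
    intro h
    obtain ⟨C, hC, hpre⟩ :=
      (relationSnd A).exists_preimage_norm_le (surjective_relationSnd_iff.2 h)
    refine ⟨C⁻¹, by positivity, fun y' x' hadj => ?_⟩
    rw [inv_mul_le_iff₀ hC]
    refine y'.opNorm_le_bound (by positivity) fun y => ?_
    obtain ⟨p, rfl, hp⟩ := hpre y
    calc ‖y' (relationSnd A p)‖ = ‖x' p.1.1‖ := by rw [hadj p.1 p.2]; rfl
      _ ≤ ‖x'‖ * ‖p.1.1‖ := x'.le_opNorm _
      _ ≤ ‖x'‖ * (C * ‖relationSnd A p‖) := by gcongr; exact (norm_fst_le p.1).trans hp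
      _ = C * ‖x'‖ * ‖relationSnd A p‖ := by ring
  tfae_have 2 → 1 := fun ⟨α, hα, h⟩ => surjective_relationSnd_iff.1 <|
    (relationSnd A).surjective_of_le_norm_comp (by positivity) (le_norm_comp_relationSnd hα h)
  tfae_have 2 ↔ 3 := by
    rw [← exists_antilipschitzWith_adjointRelationSnd_iff, ← injective_adjointRelationSnd_iff,
      ← range_adjointRelationSnd]
    have hiff (hinj : Function.Injective (adjointRelationSnd A)) :=
      ContinuousLinearMap.isClosed_range_iff_antilipschitz_of_injective
        (𝕜 := 𝕜) (E := adjointRelation A) (F := X →L[𝕜] 𝕜) (adjointRelationSnd A) hinj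
    exact ⟨fun h => ⟨h.choose_spec.injective, (hiff h.choose_spec.injective).2 h⟩,
      fun h => (hiff h.1).1 h.2⟩
  tfae_finish
end

section
/- Let X be a Banach space and A ⊆ X × X a closed relation with (0,∞) ⊆ ρ(A) and sup_{λ>0} ‖λ R(λ,A)‖ < ∞. (a) The following are equivalent: (i) the strong limit P x := lim_{λ→∞} λ R(λ,A) x exists for every x ∈ X; (ii) mul A + dom A is dense in X; (iii) X = mul A ⊕ closure(dom A) (direct sum of the subspace mul A and the closure of dom A). In that case P is the bounded projection of X onto closure(dom A) along mul A. (b) If X is reflexive, then assertions (i)–(iii) hold automatically. -/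
open Filter Topology

/-- `Q ∈ ℒ(X)` is the resolvent of the relation `A ⊆ X × X` at `l`, i.e. the relation
`l - A = {(x, l•x - y) : (x,y) ∈ A}` is invertible and `(l - A)⁻¹` is the graph of `Q`.
(In particular `l` belongs to the resolvent set `ρ(A)`.) -/
def IsResolventOf {𝕜 X : Type*} [RCLike 𝕜] [NormedAddCommGroup X] [NormedSpace 𝕜 X]
    (A : Submodule 𝕜 (X × X)) (l : 𝕜) (Q : X →L[𝕜] X) : Prop :=
  ∀ u x : X, (∃ y, (x, y) ∈ A ∧ u = l • x - y) ↔ x = Q u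

/-- The multivalued part `mul A = {y : (0,y) ∈ A}` of a relation, as a submodule of `X`. -/
def mulRel {𝕜 X : Type*} [RCLike 𝕜] [NormedAddCommGroup X] [NormedSpace 𝕜 X]
    (A : Submodule 𝕜 (X × X)) : Submodule 𝕜 X :=
  A.comap (LinearMap.inr 𝕜 X X)

/-- The domain `dom A = {x : ∃ y, (x,y) ∈ A}` of a relation, as a submodule of `X`. -/
def domRel {𝕜 X : Type*} [RCLike 𝕜] [NormedAddCommGroup X] [NormedSpace 𝕜 X]
    (A : Submodule 𝕜 (X × X)) : Submodule 𝕜 X :=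
  A.map (LinearMap.fst 𝕜 X X)

/-- Hahn–Banach: a closed subspace contains the weak limits of its nets. -/
theorem Submodule.mem_of_isClosed_of_weak_tendsto {𝕜 E ι : Type*} [RCLike 𝕜]
    [NormedAddCommGroup E] [NormedSpace 𝕜 E] {N : Submodule 𝕜 E} (hN : IsClosed (N : Set E))
    {U : Filter ι} [U.NeBot] {f : ι → E} {p : E} (hf : ∀ᶠ i in U, f i ∈ N)
    (hp : ∀ φ : StrongDual 𝕜 E, Tendsto (fun i => φ (f i)) U (𝓝 (φ p))) : p ∈ N := by
  by_contra h
  have : IsClosed (N : Set E) := hN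
  have hne : ‖N.mkQL p‖ ≠ 0 := by
    rw [norm_ne_zero_iff, Submodule.mkQL_apply, Submodule.mkQ_apply, Ne,
      Submodule.Quotient.mk_eq_zero]
    exact h
  obtain ⟨g, -, hg⟩ := exists_dual_vector 𝕜 (N.mkQL p) hne
  have hlim := hp (g.comp N.mkQL)
  have hzero : (fun i => (g.comp N.mkQL) (f i)) =ᶠ[U] fun _ => (0 : 𝕜) := by
    filter_upwards [hf] with i hi
    have : N.mkQL (f i) = 0 := by
      rw [Submodule.mkQL_apply, Submodule.mkQ_apply]
      exact (Submodule.Quotient.mk_eq_zero N).2 hi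
    simp [this, -Submodule.coe_mkQL]
  have hgp : g (N.mkQL p) = 0 :=
    tendsto_nhds_unique hlim (tendsto_const_nhds.congr' hzero.symm)
  rw [hg] at hgp
  exact hne (by exact_mod_cast hgp)

/-- In a reflexive space every bounded net has a weak limit along an ultrafilter. -/
theorem exists_weak_tendsto_of_reflexive {𝕜 X ι : Type*} [RCLike 𝕜] [NormedAddCommGroup X]
    [NormedSpace 𝕜 X] (hX : Function.Surjective (NormedSpace.inclusionInDoubleDual 𝕜 X))
    (U : Ultrafilter ι) {f : ι → X} {C : ℝ} (hf : ∀ᶠ i in (U : Filter ι), ‖f i‖ ≤ C) :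
    ∃ p : X, ∀ φ : StrongDual 𝕜 X, Tendsto (fun i => φ (f i)) U (𝓝 (φ p)) := by
  let J : ι → WeakDual 𝕜 (StrongDual 𝕜 X) := fun i =>
    StrongDual.toWeakDual (NormedSpace.inclusionInDoubleDual 𝕜 X (f i))
  have hK := WeakDual.isCompact_closedBall (𝕜 := 𝕜) (E := StrongDual 𝕜 X) 0 C
  obtain ⟨F, -, hF⟩ := hK.ultrafilter_le_nhds (U.map J) <| by
    rw [Ultrafilter.coe_map, le_principal_iff, mem_map]
    filter_upwards [hf] with i hi
    change NormedSpace.inclusionInDoubleDual 𝕜 X (f i) ∈ Metric.closedBall 0 C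
    exact (mem_closedBall_zero_iff (E := StrongDual 𝕜 (StrongDual 𝕜 X))).2
      ((NormedSpace.double_dual_bound 𝕜 X (f i)).trans hi)
  obtain ⟨p, hp⟩ := hX (WeakDual.toStrongDual F)
  refine ⟨p, fun φ => ?_⟩
  have hJ : Tendsto J U (𝓝 F) := hF
  have := tendsto_iff_forall_eval_tendsto_topDualPairing.1 hJ φ
  have hFp : φ p = F φ := by
    rw [← NormedSpace.dual_def 𝕜 X p φ, hp]
    rfl
  rw [hFp]
  exact this

namespace IsResolventOf

variable {𝕜 X : Type*} [RCLike 𝕜] [NormedAddCommGroup X] [NormedSpace 𝕜 X]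
  {A : Submodule 𝕜 (X × X)} {l : 𝕜} {Q : X →L[𝕜] X}

theorem mem (h : IsResolventOf A l Q) (u : X) : (Q u, l • Q u - u) ∈ A := by
  obtain ⟨y, hy, hu⟩ := (h u (Q u)).2 rfl
  have : l • Q u - u = y := by nth_rewrite 2 [hu]; abel
  rwa [this]

theorem apply_sub (h : IsResolventOf A l Q) {x y : X} (hxy : (x, y) ∈ A) :
    Q (l • x - y) = x :=
  ((h _ x).1 ⟨y, hxy, rfl⟩).symm

theorem apply_mulRel (h : IsResolventOf A l Q) {y : X} (hy : y ∈ mulRel A) : Q y = 0 := by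
  have := h.apply_sub (x := 0) (y := y) hy
  simpa using this

theorem smul_apply_mem_domRel (h : IsResolventOf A l Q) (u : X) : l • Q u ∈ domRel A :=
  (domRel A).smul_mem l ⟨_, h.mem u, rfl⟩

end IsResolventOf

section Resolvent

variable {𝕜 X : Type*} [RCLike 𝕜] [NormedAddCommGroup X] [NormedSpace 𝕜 X]
  {A : Submodule 𝕜 (X × X)} {R : ℝ → X →L[𝕜] X} {M : ℝ}

theorem norm_smul_resolvent_apply_le (hM : ∀ l : ℝ, 0 < l → ‖(l : 𝕜) • R l‖ ≤ M) {l : ℝ}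
    (hl : 0 < l) (x : X) : ‖(l : 𝕜) • R l x‖ ≤ M * ‖x‖ :=
  ((l : 𝕜) • R l).le_of_opNorm_le (hM l hl) x

theorem tendsto_resolvent_zero (hM : ∀ l : ℝ, 0 < l → ‖(l : 𝕜) • R l‖ ≤ M) (x : X) :
    Tendsto (fun l : ℝ => R l x) atTop (𝓝 0) := by
  have h0 : Tendsto (fun l : ℝ => l⁻¹ * (M * ‖x‖)) atTop (𝓝 0) := by
    simpa using tendsto_inv_atTop_zero.mul_const (M * ‖x‖)
  refine squeeze_zero_norm' ?_ h0
  filter_upwards [eventually_gt_atTop 0] with l hl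
  have := norm_smul_resolvent_apply_le hM hl x
  rw [norm_smul, RCLike.norm_ofReal, abs_of_pos hl] at this
  rwa [inv_mul_eq_div, le_div_iff₀ hl, mul_comm]

theorem tendsto_smul_resolvent_of_mem_domRel
    (hR : ∀ l : ℝ, 0 < l → IsResolventOf A (l : 𝕜) (R l))
    (hM : ∀ l : ℝ, 0 < l → ‖(l : 𝕜) • R l‖ ≤ M) {x : X} (hx : x ∈ domRel A) :
    Tendsto (fun l : ℝ => (l : 𝕜) • R l x) atTop (𝓝 x) := by
  obtain ⟨⟨x, y⟩, hxy, rfl⟩ := hx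
  have h : Tendsto (fun l : ℝ => x + R l y) atTop (𝓝 x) := by
    simpa using (tendsto_resolvent_zero hM y).const_add x
  refine h.congr' ?_
  filter_upwards [eventually_gt_atTop 0] with l hl
  have := (hR l hl).apply_sub hxy
  rw [map_sub, map_smul, sub_eq_iff_eq_add] at this
  exact this.symm

theorem tendsto_smul_resolvent_of_mem_closure
    (hR : ∀ l : ℝ, 0 < l → IsResolventOf A (l : 𝕜) (R l))
    (hM : ∀ l : ℝ, 0 < l → ‖(l : 𝕜) • R l‖ ≤ M) {x : X}
    (hx : x ∈ (domRel A).topologicalClosure) :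
    Tendsto (fun l : ℝ => (l : 𝕜) • R l x) atTop (𝓝 x) := by
  have hM0 : 0 ≤ M := (norm_nonneg _).trans (hM 1 one_pos)
  rw [Metric.tendsto_nhds]
  intro ε hε
  obtain ⟨d, hd, hxd⟩ := Metric.mem_closure_iff.1 hx (ε / (2 * (M + 1))) (by positivity)
  rw [dist_eq_norm, lt_div_iff₀ (by positivity)] at hxd
  filter_upwards [eventually_gt_atTop 0, Metric.tendsto_nhds.1
    (tendsto_smul_resolvent_of_mem_domRel hR hM hd) (ε / 2) (half_pos hε)] with l hl hld
  rw [dist_eq_norm] at hld ⊢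
  have h1 := norm_smul_resolvent_apply_le hM hl (x - d)
  have h2 : (l : 𝕜) • R l x - x =
      (l : 𝕜) • R l (x - d) + ((l : 𝕜) • R l d - d) - (x - d) := by
    rw [map_sub, smul_sub]; abel
  have h3 := norm_sub_le ((l : 𝕜) • R l (x - d) + ((l : 𝕜) • R l d - d)) (x - d)
  have h4 := norm_add_le ((l : 𝕜) • R l (x - d)) ((l : 𝕜) • R l d - d)
  rw [h2]
  linarith

theorem tendsto_smul_resolvent_of_mem_mulRel
    (hR : ∀ l : ℝ, 0 < l → IsResolventOf A (l : 𝕜) (R l)) {x : X} (hx : x ∈ mulRel A) :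
    Tendsto (fun l : ℝ => (l : 𝕜) • R l x) atTop (𝓝 0) := by
  refine tendsto_const_nhds.congr' ?_
  filter_upwards [eventually_gt_atTop 0] with l hl
  rw [(hR l hl).apply_mulRel hx, smul_zero]

/-- Weak cluster points of `l R(l,A) x` as `l → ∞` lie in the closure of `dom A`, and differ
from `x` by an element of `mul A`. -/
theorem mem_of_weak_tendsto_smul_resolvent (hA : IsClosed (A : Set (X × X)))
    (hR : ∀ l : ℝ, 0 < l → IsResolventOf A (l : 𝕜) (R l))
    (hM : ∀ l : ℝ, 0 < l → ‖(l : 𝕜) • R l‖ ≤ M) {U : Filter ℝ} [U.NeBot] (hU : U ≤ atTop)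
    {x p : X} (hp : ∀ φ : StrongDual 𝕜 X,
      Tendsto (fun l : ℝ => φ ((l : 𝕜) • R l x)) U (𝓝 (φ p))) :
    p ∈ (domRel A).topologicalClosure ∧ x - p ∈ mulRel A := by
  have hpos : ∀ᶠ l : ℝ in U, 0 < l := hU (eventually_gt_atTop 0)
  constructor
  · refine Submodule.mem_of_isClosed_of_weak_tendsto (Submodule.isClosed_topologicalClosure _)
      (U := U) ?_ hp
    filter_upwards [hpos] with l hl
    exact Submodule.le_topologicalClosure _ ((hR l hl).smul_apply_mem_domRel x)
  · rw [← neg_mem_iff, neg_sub]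
    change ((0 : X), p - x) ∈ A
    refine Submodule.mem_of_isClosed_of_weak_tendsto hA (U := U)
      (f := fun l => (R l x, (l : 𝕜) • R l x - x)) ?_ fun φ => ?_
    · filter_upwards [hpos] with l hl
      exact (hR l hl).mem x
    · have hφ : ∀ a b : X, φ (a, b) =
          φ.comp (ContinuousLinearMap.inl 𝕜 X X) a + φ.comp (ContinuousLinearMap.inr 𝕜 X X) b := by
        intro a b
        simp [← map_add]
      simp only [hφ, map_sub _ _ x]
      exact (((ContinuousLinearMap.continuous _).tendsto 0).comp
        ((tendsto_resolvent_zero hM x).mono_left hU)).add ((hp _).sub_const _)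

theorem mem_of_tendsto_smul_resolvent (hA : IsClosed (A : Set (X × X)))
    (hR : ∀ l : ℝ, 0 < l → IsResolventOf A (l : 𝕜) (R l))
    (hM : ∀ l : ℝ, 0 < l → ‖(l : 𝕜) • R l‖ ≤ M) {x p : X}
    (hp : Tendsto (fun l : ℝ => (l : 𝕜) • R l x) atTop (𝓝 p)) :
    p ∈ (domRel A).topologicalClosure ∧ x - p ∈ mulRel A :=
  mem_of_weak_tendsto_smul_resolvent hA hR hM le_rfl fun φ => (φ.continuous.tendsto p).comp hp

theorem exists_tendsto_smul_resolvent_of_dense [CompleteSpace X]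
    (hR : ∀ l : ℝ, 0 < l → IsResolventOf A (l : 𝕜) (R l))
    (hM : ∀ l : ℝ, 0 < l → ‖(l : 𝕜) • R l‖ ≤ M)
    (hd : Dense ((mulRel A ⊔ domRel A : Submodule 𝕜 X) : Set X)) (x : X) :
    ∃ p : X, Tendsto (fun l : ℝ => (l : 𝕜) • R l x) atTop (𝓝 p) := by
  have hM0 : 0 ≤ M := (norm_nonneg _).trans (hM 1 one_pos)
  apply cauchySeq_tendsto_of_complete
  rw [Metric.cauchySeq_iff']
  intro ε hε
  obtain ⟨z, hz, hxz⟩ := Metric.mem_closure_iff.1 (hd x) (ε / (4 * (M + 1))) (by positivity)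
  rw [dist_eq_norm, lt_div_iff₀ (by positivity)] at hxz
  obtain ⟨m, hm, d, hdd, rfl⟩ := Submodule.mem_sup.1 hz
  have hlim : Tendsto (fun l : ℝ => (l : 𝕜) • R l (m + d)) atTop (𝓝 d) := by
    simpa using (tendsto_smul_resolvent_of_mem_mulRel hR hm).add
      (tendsto_smul_resolvent_of_mem_domRel hR hM hdd)
  obtain ⟨N, hN⟩ := eventually_atTop.1 ((eventually_gt_atTop 0).and
    (Metric.tendsto_nhds.1 hlim (ε / 4) (by positivity)))
  refine ⟨N, fun n hn => ?_⟩
  have key : ∀ l : ℝ, N ≤ l → dist ((l : 𝕜) • R l x) d < ε / 2 := by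
    intro l hl
    obtain ⟨hl0, hld⟩ := hN l hl
    have h1 := norm_smul_resolvent_apply_le hM hl0 (x - (m + d))
    rw [map_sub, smul_sub, ← dist_eq_norm] at h1
    have h2 := dist_triangle ((l : 𝕜) • R l x) ((l : 𝕜) • R l (m + d)) d
    have h3 := norm_nonneg (x - (m + d))
    linarith
  linarith [key n hn, key N le_rfl, dist_triangle_right ((n : 𝕜) • R n x) ((N : 𝕜) • R N x) d]

end Resolvent

/-- Let `A` be a closed relation with `(0,∞) ⊆ ρ(A)` and `sup_{l>0} ‖l R(l,A)‖ < ∞`.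
(a) The strong limit `P = lim_{l→∞} l R(l,A)` exists iff `mul A + dom A` is dense iff
`X = mul A ⊕ closure(dom A)`; in that case `P` is the projection onto `closure(dom A)`
along `mul A`. (b) If `X` is reflexive, these assertions hold automatically. -/
theorem stmt_16 {𝕜 X : Type*} [RCLike 𝕜] [NormedAddCommGroup X] [NormedSpace 𝕜 X]
    [CompleteSpace X] (A : Submodule 𝕜 (X × X)) (hA : IsClosed (A : Set (X × X)))
    (R : ℝ → X →L[𝕜] X) (hR : ∀ l : ℝ, 0 < l → IsResolventOf A (l : 𝕜) (R l))
    (M : ℝ) (hM : ∀ l : ℝ, 0 < l → ‖(l : 𝕜) • R l‖ ≤ M) :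
    -- (a) the three assertions are equivalent
    List.TFAE
      [ -- (i) the strong limit of l R(l,A) as l → ∞ exists
        ∀ x : X, ∃ p : X, Tendsto (fun l : ℝ => (l : 𝕜) • R l x) atTop (𝓝 p),
        -- (ii) mul A + dom A is dense in X
        Dense ((mulRel A ⊔ domRel A : Submodule 𝕜 X) : Set X),
        -- (iii) X = mul A ⊕ closure(dom A)
        IsCompl (mulRel A) ((domRel A).topologicalClosure) ] ∧
    -- in that case, P is the projection onto closure(dom A) along mul A
    ((∀ x : X, ∃ p : X, Tendsto (fun l : ℝ => (l : 𝕜) • R l x) atTop (𝓝 p)) →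
      ∃ P : X →L[𝕜] X,
        (∀ x : X, Tendsto (fun l : ℝ => (l : 𝕜) • R l x) atTop (𝓝 (P x))) ∧
        ∀ x : X, P x ∈ (domRel A).topologicalClosure ∧ x - P x ∈ mulRel A) ∧
    -- (b) if X is reflexive then (i)-(iii) hold automatically
    (Function.Surjective (NormedSpace.inclusionInDoubleDual 𝕜 X) →
      ∀ x : X, ∃ p : X, Tendsto (fun l : ℝ => (l : 𝕜) • R l x) atTop (𝓝 p)) := by
  have hi : (∀ x : X, ∃ p : X, Tendsto (fun l : ℝ => (l : 𝕜) • R l x) atTop (𝓝 p)) →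
      IsCompl (mulRel A) ((domRel A).topologicalClosure) := by
    intro h
    refine ⟨Submodule.disjoint_def.2 fun x hx hx' => ?_, codisjoint_iff_le_sup.2 fun x _ => ?_⟩
    · exact tendsto_nhds_unique (tendsto_smul_resolvent_of_mem_closure hR hM hx')
        (tendsto_smul_resolvent_of_mem_mulRel hR hx)
    · obtain ⟨p, hp⟩ := h x
      obtain ⟨h1, h2⟩ := mem_of_tendsto_smul_resolvent hA hR hM hp
      exact Submodule.mem_sup.2 ⟨x - p, h2, p, h1, sub_add_cancel x p⟩
  refine ⟨?_, fun h => ?_, fun hX x => ?_⟩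
  · tfae_have 1 → 3 := hi
    tfae_have 3 → 2 := by
      intro h
      rw [Submodule.dense_iff_topologicalClosure_eq_top, eq_top_iff, ← h.sup_eq_top]
      exact sup_le (le_sup_left.trans (Submodule.le_topologicalClosure _))
        (Submodule.topologicalClosure_mono le_sup_right)
    tfae_have 2 → 1 := exists_tendsto_smul_resolvent_of_dense hR hM
    tfae_finish
  · choose P hP using h
    refine ⟨continuousLinearMapOfTendsto (fun l : ℝ => (l : 𝕜) • R l) (f := P)
      (tendsto_pi_nhds.2 hP), hP, fun x => mem_of_tendsto_smul_resolvent hA hR hM (hP x)⟩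
  · obtain ⟨p, hp⟩ := exists_weak_tendsto_of_reflexive hX (Ultrafilter.of atTop)
      (f := fun l : ℝ => (l : 𝕜) • R l x) (C := M * ‖x‖) <| by
        filter_upwards [Ultrafilter.of_le _ (eventually_gt_atTop (0 : ℝ))] with l hl
        exact norm_smul_resolvent_apply_le hM hl x
    obtain ⟨h1, h2⟩ := mem_of_weak_tendsto_smul_resolvent hA hR hM (Ultrafilter.of_le _) hp
    refine ⟨p, ?_⟩
    simpa [smul_sub] using (tendsto_smul_resolvent_of_mem_mulRel hR h2).add
      (tendsto_smul_resolvent_of_mem_closure hR hM h1)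
end

section
/- Let X be a Banach space and A ⊆ X × X an m-dissipative relation. Then there exists a unique function S : [0,∞) → ℒ(X) such that (a) S(0) = 0; (b) ‖S(t) − S(s)‖ ≤ |t − s| for all s, t ≥ 0; and (c) R(λ,A)x = λ ∫₀^∞ e^{-λt} S(t)x dt for all λ > 0 and all x ∈ X. Moreover this S satisfies the functional equation (d) S(t)S(s)x = ∫_t^{t+s} S(r)x dr − ∫₀^s S(r)x dr for all t, s ≥ 0 and x ∈ X. -/
open Filter Topology MeasureTheory

/-- A relation `A ⊆ X × X` is dissipative if `‖lx‖ ≤ ‖lx - y‖` for all `(x,y) ∈ A`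
and all real `l > 0`. -/
def Dissipative {𝕜 X : Type*} [RCLike 𝕜] [NormedAddCommGroup X] [NormedSpace 𝕜 X]
    (A : Submodule 𝕜 (X × X)) : Prop :=
  ∀ p ∈ A, ∀ l : ℝ, 0 < l → ‖(l : 𝕜) • p.1‖ ≤ ‖(l : 𝕜) • p.1 - p.2‖

section LaplaceApproximation

open Set

variable {E : Type*} [NormedAddCommGroup E] [NormedSpace ℝ E]

theorem integrableOn_exp_neg_mul_Ioi {l : ℝ} (hl : 0 < l) :
    IntegrableOn (fun r : ℝ => Real.exp (-(l * r))) (Ioi 0) := by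
  simpa [neg_mul] using integrableOn_exp_mul_Ioi (neg_lt_zero.2 hl) 0

theorem norm_exp_smul_le_of_linear_growth {x : E} {C r l : ℝ} (hC : 0 ≤ C) (hr : 0 < r)
    (hx : ‖x‖ ≤ C * (1 + r)) (hl : 0 < l) :
    ‖Real.exp (-(l * r)) • x‖ ≤ C * (1 + 2 / l) * Real.exp (-(l / 2 * r)) := by
  have h1 : 1 + r ≤ (1 + 2 / l) * Real.exp (l / 2 * r) := by
    have h2 : 1 + l / 2 * r ≤ Real.exp (l / 2 * r) := by
      linarith [Real.add_one_le_exp (l / 2 * r)]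
    have h3 : (1 + 2 / l) * (1 + l / 2 * r) = 1 + r + (2 / l + l / 2 * r) := by
      field_simp; ring
    have h4 : 0 < 2 / l + l / 2 * r := by positivity
    calc 1 + r ≤ (1 + 2 / l) * (1 + l / 2 * r) := by linarith
      _ ≤ _ := by gcongr
  rw [norm_smul, Real.norm_eq_abs, Real.abs_exp]
  calc Real.exp (-(l * r)) * ‖x‖
      ≤ Real.exp (-(l * r)) * (C * ((1 + 2 / l) * Real.exp (l / 2 * r))) := by
        gcongr
        exact hx.trans (by gcongr)
    _ = C * (1 + 2 / l) * (Real.exp (-(l * r)) * Real.exp (l / 2 * r)) := by ring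
    _ = C * (1 + 2 / l) * Real.exp (-(l / 2 * r)) := by
        rw [← Real.exp_add]; ring_nf

theorem integrableOn_exp_smul_of_linear_growth {h : ℝ → E}
    (hm : AEStronglyMeasurable h (volume.restrict (Ioi 0))) {C : ℝ} (hC : 0 ≤ C)
    (hb : ∀ r, 0 < r → ‖h r‖ ≤ C * (1 + r)) {l : ℝ} (hl : 0 < l) :
    IntegrableOn (fun r : ℝ => Real.exp (-(l * r)) • h r) (Ioi 0) := by
  refine Integrable.mono'
    ((integrableOn_exp_neg_mul_Ioi (half_pos hl)).const_mul (C * (1 + 2 / l))) ?_ ?_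
  · exact (by fun_prop : Continuous fun r : ℝ => Real.exp (-(l * r))).aestronglyMeasurable.smul hm
  · filter_upwards [ae_restrict_mem measurableSet_Ioi] with r hr
    have hr : 0 < r := hr
    exact norm_exp_smul_le_of_linear_growth hC hr (hb r hr) hl

/-- The exponential polynomials `∑ cₖ e^{-(k+1)r}` are dense in `L¹(0,∞)`. -/
theorem exists_exp_polynomial_integral_sub_le {f : ℝ → ℝ} (hf : Integrable f) {ε : ℝ}
    (hε : 0 < ε) :
    ∃ p : Polynomial ℝ,
      IntegrableOn (fun r => Real.exp (-r) * p.eval (Real.exp (-r))) (Ioi 0) ∧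
      ∫ r in Ioi (0 : ℝ), |f r - Real.exp (-r) * p.eval (Real.exp (-r))| ≤ ε := by
  obtain ⟨g, hgs, hfg, hgc, hgi⟩ :=
    hf.exists_hasCompactSupport_integral_sub_le (half_pos hε)
  obtain ⟨M, hM⟩ := hgs.isCompact.isBounded.subset_closedBall 0
  have hg0 : ∀ r, M < r → g r = 0 := fun r hr => by
    by_contra hne
    have := hM (subset_tsupport g hne)
    rw [mem_closedBall_zero_iff, Real.norm_eq_abs] at this
    linarith [le_abs_self r]
  have hgM : g (M + 1) = 0 := hg0 _ (by linarith)
  have hδ : 0 < Real.exp (-(M + 1)) := Real.exp_pos _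
  have hmax : ∀ u, 0 < max u (Real.exp (-(M + 1))) := fun u => lt_max_of_lt_right hδ
  obtain ⟨p, hp⟩ := exists_polynomial_near_of_continuousOn 0 1
    (fun u => g (-Real.log (max u (Real.exp (-(M + 1))))) / max u (Real.exp (-(M + 1))))
    (by
      have hc : Continuous fun u : ℝ => max u (Real.exp (-(M + 1))) := by fun_prop
      exact ((hgc.comp (hc.log fun u => (hmax u).ne').neg).div hc
        fun u => (hmax u).ne').continuousOn) (ε / 2) (half_pos hε)
  have hkey : ∀ r, 0 < r →
      |g r - Real.exp (-r) * p.eval (Real.exp (-r))| ≤ ε / 2 * Real.exp (-r) := by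
    intro r hr
    have h1 := (hp (Real.exp (-r)) ⟨(Real.exp_pos _).le, Real.exp_le_one_iff.2 (by linarith)⟩).le
    have h2 : g (-Real.log (max (Real.exp (-r)) (Real.exp (-(M + 1))))) /
        max (Real.exp (-r)) (Real.exp (-(M + 1))) = g r / Real.exp (-r) := by
      rcases le_total r (M + 1) with h | h
      · rw [max_eq_left (Real.exp_le_exp.2 (by linarith)), Real.log_exp, neg_neg]
      · rw [max_eq_right (Real.exp_le_exp.2 (by linarith)), Real.log_exp, neg_neg, hgM,
          hg0 r (by linarith)]
        simp
    rw [h2] at h1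
    have h3 : g r - Real.exp (-r) * p.eval (Real.exp (-r)) =
        -(Real.exp (-r) * (p.eval (Real.exp (-r)) - g r / Real.exp (-r))) := by
      field_simp; ring
    rw [h3, abs_neg, abs_mul, Real.abs_exp, mul_comm]
    gcongr
  have hei : IntegrableOn (fun r : ℝ => Real.exp (-r)) (Ioi 0) := by
    simpa using integrableOn_exp_neg_mul_Ioi one_pos
  have hPc : Continuous fun r : ℝ => Real.exp (-r) * p.eval (Real.exp (-r)) := by
    fun_prop
  have hdi : IntegrableOn (fun r => g r - Real.exp (-r) * p.eval (Real.exp (-r))) (Ioi 0) := by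
    refine Integrable.mono' (hei.const_mul (ε / 2)) (hgc.sub hPc).aestronglyMeasurable ?_
    filter_upwards [ae_restrict_mem measurableSet_Ioi] with r hr using hkey r hr
  have hPi : IntegrableOn (fun r => Real.exp (-r) * p.eval (Real.exp (-r))) (Ioi 0) := by
    have := hgi.integrableOn.sub hdi
    refine this.congr (ae_of_all _ fun r => ?_)
    simp
  refine ⟨p, hPi, ?_⟩
  have hfgi : Integrable (fun r => |f r - g r|) := (hf.sub hgi).abs
  calc ∫ r in Ioi (0 : ℝ), |f r - Real.exp (-r) * p.eval (Real.exp (-r))|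
      ≤ ∫ r in Ioi (0 : ℝ), (|f r - g r| + ε / 2 * Real.exp (-r)) := by
        refine setIntegral_mono_on (hf.integrableOn.sub hPi).abs
          (hfgi.integrableOn.add (hei.const_mul _)) measurableSet_Ioi fun r hr => ?_
        exact (abs_sub_le _ (g r) _).trans (by gcongr; exact hkey r hr)
    _ = (∫ r in Ioi (0 : ℝ), |f r - g r|) + ε / 2 := by
        rw [integral_add hfgi.integrableOn (hei.const_mul _), integral_const_mul,
          integral_exp_neg_Ioi_zero, mul_one]
    _ ≤ ε / 2 + ε / 2 := by
        gcongr
        exact (setIntegral_le_integral hfgi (ae_of_all _ fun r => abs_nonneg _)).trans hfg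
    _ = ε := by ring

theorem norm_integral_smul_sub_le {f P : ℝ → ℝ} (hf : IntegrableOn f (Ioi 0))
    (hP : IntegrableOn P (Ioi 0)) {ε : ℝ} (hε : ∫ r in Ioi (0 : ℝ), |f r - P r| ≤ ε)
    {h : ℝ → E} (hm : AEStronglyMeasurable h (volume.restrict (Ioi 0))) {C : ℝ} (hC : 0 ≤ C)
    (hb : ∀ r, 0 < r → ‖h r‖ ≤ C) :
    ‖(∫ r in Ioi (0 : ℝ), f r • h r) - ∫ r in Ioi (0 : ℝ), P r • h r‖ ≤ C * ε := by
  have hb' : ∀ᵐ r ∂(volume.restrict (Ioi (0 : ℝ))), ‖h r‖ ≤ C := by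
    filter_upwards [ae_restrict_mem measurableSet_Ioi] with r hr using hb r hr
  have hfh : IntegrableOn (fun r => f r • h r) (Ioi 0) := hf.smul_bdd C hm hb'
  have hPh : IntegrableOn (fun r => P r • h r) (Ioi 0) := hP.smul_bdd C hm hb'
  rw [← integral_sub hfh hPh]
  calc _ ≤ ∫ r in Ioi (0 : ℝ), C * |f r - P r| := by
        refine norm_integral_le_of_norm_le ((hf.sub hP).abs.const_mul C) ?_
        filter_upwards [hb'] with r hr
        rw [← sub_smul, norm_smul, Real.norm_eq_abs, mul_comm]
        gcongr
    _ ≤ C * ε := by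
        rw [integral_const_mul]; gcongr

theorem integral_exp_polynomial_smul {h : ℝ → E}
    (hm : AEStronglyMeasurable h (volume.restrict (Ioi 0))) {C : ℝ} (hC : 0 ≤ C)
    (hb : ∀ r, 0 < r → ‖h r‖ ≤ C) (p : Polynomial ℝ) :
    ∫ r in Ioi (0 : ℝ), (Real.exp (-r) * p.eval (Real.exp (-r))) • h r =
      ∑ k ∈ Finset.range (p.natDegree + 1),
        p.coeff k • ∫ r in Ioi (0 : ℝ), Real.exp (-(((k : ℝ) + 1) * r)) • h r := by
  have hi : ∀ k : ℕ, IntegrableOn (fun r : ℝ => Real.exp (-(((k : ℝ) + 1) * r)) • h r) (Ioi 0) :=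
    fun k => integrableOn_exp_smul_of_linear_growth hm hC
      (fun r hr => (hb r hr).trans (by nlinarith)) (by positivity)
  simp_rw [← integral_smul]
  have hi' : ∀ k : ℕ, IntegrableOn
      (fun r : ℝ => p.coeff k • Real.exp (-(((k : ℝ) + 1) * r)) • h r) (Ioi 0) :=
    fun k => (hi k).smul (p.coeff k)
  rw [← integral_finsetSum _ fun k _ => hi' k]
  refine integral_congr_ae (ae_of_all _ fun r => ?_)
  simp only [Polynomial.eval_eq_sum_range, Finset.mul_sum, Finset.sum_smul, smul_smul]
  refine Finset.sum_congr rfl fun k _ => ?_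
  congr 1
  rw [← Real.exp_nat_mul, mul_left_comm, ← Real.exp_add]
  ring_nf

/-- If the Laplace transforms of uniformly bounded functions converge, then so do their integrals
against every integrable function. -/
theorem cauchySeq_integral_smul_of_laplace {q : ℕ → ℝ → E}
    (hm : ∀ n, AEStronglyMeasurable (q n) (volume.restrict (Ioi 0)))
    (hb : ∀ n r, 0 < r → ‖q n r‖ ≤ 1)
    (hq : ∀ l : ℝ, 0 < l →
      ∃ y, Tendsto (fun n => ∫ r in Ioi (0 : ℝ), Real.exp (-(l * r)) • q n r) atTop (𝓝 y))
    {f : ℝ → ℝ} (hf : Integrable f) :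
    CauchySeq fun n => ∫ r in Ioi (0 : ℝ), f r • q n r := by
  rw [Metric.cauchySeq_iff']
  intro ε hε
  obtain ⟨p, hPi, hp⟩ := exists_exp_polynomial_integral_sub_le hf (ε := ε / 4) (by linarith)
  have hclose := fun n =>
    norm_integral_smul_sub_le hf.integrableOn hPi hp (hm n) zero_le_one (hb n)
  have hc : CauchySeq fun n =>
      ∫ r in Ioi (0 : ℝ), (Real.exp (-r) * p.eval (Real.exp (-r))) • q n r := by
    choose y hy using fun k : ℕ => hq ((k : ℝ) + 1) (by positivity)
    refine Tendsto.cauchySeq (x := ∑ k ∈ Finset.range (p.natDegree + 1), p.coeff k • y k) ?_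
    simp_rw [fun n => integral_exp_polynomial_smul (hm n) zero_le_one (hb n) p]
    exact tendsto_finsetSum _ fun k _ => (hy k).const_smul _
  obtain ⟨N, hN⟩ := Metric.cauchySeq_iff'.1 hc (ε / 4) (by linarith)
  refine ⟨N, fun n hn => ?_⟩
  have h1 := hclose n
  have h2 := hclose N
  have h3 := hN n hn
  rw [← dist_eq_norm] at h1 h2
  rw [dist_comm] at h2
  linarith [dist_triangle4 (∫ r in Ioi (0 : ℝ), f r • q n r)
    (∫ r in Ioi (0 : ℝ), (Real.exp (-r) * p.eval (Real.exp (-r))) • q n r)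
    (∫ r in Ioi (0 : ℝ), (Real.exp (-r) * p.eval (Real.exp (-r))) • q N r)
    (∫ r in Ioi (0 : ℝ), f r • q N r)]

theorem integral_indicator_smul_Ioi (h : ℝ → E) {t : ℝ} (ht : 0 ≤ t) :
    ∫ r in Ioi (0 : ℝ), (Ioc 0 t).indicator (fun _ => (1 : ℝ)) r • h r =
      ∫ r in (0 : ℝ)..t, h r := by
  rw [intervalIntegral.integral_of_le ht]
  have h1 : ∀ r, (Ioc 0 t).indicator (fun _ => (1 : ℝ)) r • h r = (Ioc 0 t).indicator h r := by
    intro r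
    by_cases hr : r ∈ Ioc 0 t <;> simp [hr]
  simp_rw [h1]
  rw [setIntegral_indicator measurableSet_Ioc, inter_eq_right.2 Ioc_subset_Ioi_self]

theorem integrable_indicator_Ioc_one (t : ℝ) :
    Integrable ((Ioc 0 t).indicator fun _ => (1 : ℝ)) :=
  (integrable_indicator_iff measurableSet_Ioc).2 (integrableOn_const (by simp))

/-- Uniqueness of the Laplace transform for continuous functions of linear growth. -/
theorem eq_zero_of_laplace_eq_zero [CompleteSpace E] {h : ℝ → E} (hc : Continuous h) {C : ℝ} (hC : 0 ≤ C)
    (hb : ∀ r, 0 < r → ‖h r‖ ≤ C * (1 + r))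
    (hL : ∀ l : ℝ, 0 < l → ∫ r in Ioi (0 : ℝ), Real.exp (-(l * r)) • h r = 0)
    {t : ℝ} (ht : 0 ≤ t) : h t = 0 := by
  set k : ℝ → E := fun r => Real.exp (-r) • h r with hk
  have hkc : Continuous k := by fun_prop
  have hkb : ∀ r, 0 < r → ‖k r‖ ≤ C := fun r hr => by
    rw [hk, norm_smul, Real.norm_eq_abs, Real.abs_exp]
    calc Real.exp (-r) * ‖h r‖ ≤ Real.exp (-r) * (C * Real.exp r) := by
          gcongr
          exact (hb r hr).trans (by gcongr; linarith [Real.add_one_le_exp r])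
      _ = C * (Real.exp (-r) * Real.exp r) := by ring
      _ = C := by rw [← Real.exp_add]; simp
  have hkm : AEStronglyMeasurable k (volume.restrict (Ioi 0)) := hkc.aestronglyMeasurable
  have hint : ∀ s, 0 ≤ s → ∫ r in (0 : ℝ)..s, k r = 0 := by
    intro s hs
    rw [← integral_indicator_smul_Ioi k hs, ← norm_le_zero_iff]
    refine le_of_forall_pos_le_add fun ε hε => ?_
    obtain ⟨p, hPi, hp⟩ := exists_exp_polynomial_integral_sub_le
      (integrable_indicator_Ioc_one s) (ε := ε / (C + 1)) (by positivity)
    have h1 := norm_integral_smul_sub_le (integrable_indicator_Ioc_one s).integrableOn hPi hp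
      hkm hC hkb
    rw [integral_exp_polynomial_smul hkm hC hkb, Finset.sum_eq_zero, sub_zero] at h1
    · refine h1.trans ?_
      rw [zero_add, mul_div_assoc', div_le_iff₀ (by positivity)]
      nlinarith
    · intro j _
      have hj : ∫ r in Ioi (0 : ℝ), Real.exp (-(((j : ℝ) + 1) * r)) • k r = 0 := by
        rw [← hL ((j : ℝ) + 1 + 1) (by positivity)]
        refine setIntegral_congr_fun measurableSet_Ioi fun r _ => ?_
        simp only [hk]
        rw [smul_smul, ← Real.exp_add]
        ring_nf
      rw [hj, smul_zero]
  have hd : HasDerivWithinAt (fun s => ∫ r in (0 : ℝ)..s, k r) (k t) (Ici t) t :=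
    (intervalIntegral.integral_hasDerivAt_right (hkc.intervalIntegrable _ _)
      (hkc.stronglyMeasurableAtFilter _ _) hkc.continuousAt).hasDerivWithinAt
  have hd0 : HasDerivWithinAt (fun s => ∫ r in (0 : ℝ)..s, k r) 0 (Ici t) t :=
    (hasDerivWithinAt_const t (Ici t) (0 : E)).congr (fun s hs => hint s (ht.trans hs)) (hint t ht)
  have hkt : k t = 0 := (uniqueDiffWithinAt_Ici t).eq_deriv _ hd hd0
  exact (smul_eq_zero.1 hkt).resolve_left (Real.exp_pos _).ne'

theorem tendsto_exp_smul_of_linear_growth {h : ℝ → E} {C : ℝ} (hC : 0 ≤ C)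
    (hb : ∀ r, 0 < r → ‖h r‖ ≤ C * (1 + r)) {l : ℝ} (hl : 0 < l) :
    Tendsto (fun r : ℝ => Real.exp (-(l * r)) • h r) atTop (𝓝 0) := by
  have ht : Tendsto (fun r : ℝ => C * (1 + 2 / l) * Real.exp (-(l / 2 * r))) atTop (𝓝 0) := by
    rw [← mul_zero (C * (1 + 2 / l))]
    exact (Real.tendsto_exp_neg_atTop_nhds_zero.comp
      (tendsto_id.const_mul_atTop (half_pos hl))).const_mul _
  refine squeeze_zero_norm' ?_ ht
  filter_upwards [eventually_gt_atTop 0] with r hr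
  exact norm_exp_smul_le_of_linear_growth hC hr (hb r hr) hl

theorem norm_primitive_le {g : ℝ → E} {C : ℝ} (hC : 0 ≤ C) (hb : ∀ r, 0 < r → ‖g r‖ ≤ C)
    {t : ℝ} (ht : 0 < t) : ‖∫ r in (0 : ℝ)..t, g r‖ ≤ C * (1 + t) := by
  have h1 := intervalIntegral.norm_integral_le_of_norm_le_const (a := 0) (b := t) (f := g)
    (C := C) fun r hr => hb r (by rw [uIoc_of_le ht.le] at hr; exact hr.1)
  rw [sub_zero, abs_of_pos ht] at h1
  nlinarith

/-- The Laplace transform of a primitive. -/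
theorem smul_laplace_primitive [CompleteSpace E] {g : ℝ → E} (hg : Continuous g) {C : ℝ}
    (hC : 0 ≤ C) (hb : ∀ r, 0 < r → ‖g r‖ ≤ C) {l : ℝ} (hl : 0 < l) :
    l • ∫ t in Ioi (0 : ℝ), Real.exp (-(l * t)) • ∫ r in (0 : ℝ)..t, g r =
      ∫ t in Ioi (0 : ℝ), Real.exp (-(l * t)) • g t := by
  have hGd : ∀ t, HasDerivAt (fun t => ∫ r in (0 : ℝ)..t, g r) (g t) t := fun t =>
    intervalIntegral.integral_hasDerivAt_right (hg.intervalIntegrable _ _)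
      (hg.stronglyMeasurableAtFilter _ _) hg.continuousAt
  have hGc : Continuous fun t => ∫ r in (0 : ℝ)..t, g r :=
    continuous_iff_continuousAt.2 fun t => (hGd t).continuousAt
  have hGb : ∀ t, 0 < t → ‖∫ r in (0 : ℝ)..t, g r‖ ≤ C * (1 + t) :=
    fun t ht => norm_primitive_le hC hb ht
  have hi1 := integrableOn_exp_smul_of_linear_growth hg.aestronglyMeasurable hC
    (fun r hr => (hb r hr).trans (by nlinarith)) hl
  have hi2 := integrableOn_exp_smul_of_linear_growth hGc.aestronglyMeasurable hC hGb hl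
  have hi3 : IntegrableOn
      (fun t => l • Real.exp (-(l * t)) • ∫ r in (0 : ℝ)..t, g r) (Ioi 0) := hi2.smul l
  have hd : ∀ t ∈ Ici (0 : ℝ),
      HasDerivAt (fun t : ℝ => Real.exp (-(l * t)) • ∫ r in (0 : ℝ)..t, g r)
        (Real.exp (-(l * t)) • g t - l • Real.exp (-(l * t)) • ∫ r in (0 : ℝ)..t, g r) t := by
    intro t _
    have he : HasDerivAt (fun t : ℝ => Real.exp (-(l * t))) (Real.exp (-(l * t)) * -(l * 1)) t :=
      ((hasDerivAt_id t).const_mul l).neg.exp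
    refine (he.smul (hGd t)).congr_deriv ?_
    module
  have h := integral_Ioi_of_hasDerivAt_of_tendsto' hd (hi1.sub hi3)
    (tendsto_exp_smul_of_linear_growth hC hGb hl)
  rw [integral_sub hi1 hi3, integral_smul] at h
  simp only [intervalIntegral.integral_same, smul_zero, sub_zero] at h
  exact (sub_eq_zero.1 h).symm

theorem integral_exp_neg_mul_Ioi {l : ℝ} (hl : 0 < l) :
    ∫ r in Ioi (0 : ℝ), Real.exp (-(l * r)) = l⁻¹ := by
  simpa [neg_mul, neg_div_neg_eq] using integral_exp_mul_Ioi (neg_lt_zero.2 hl) 0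

end LaplaceApproximation

section YosidaApproximation

open Set

variable {B : Type*} [NormedRing B] [NormedAlgebra ℝ B]

theorem norm_exp_le_exp_norm (h1 : ‖(1 : B)‖ ≤ 1) (x : B) :
    ‖NormedSpace.exp x‖ ≤ Real.exp ‖x‖ := by
  rw [NormedSpace.exp_eq_tsum ℝ, Real.exp_eq_exp_ℝ]
  refine tsum_of_norm_bounded (NormedSpace.expSeries_div_hasSum_exp ‖x‖) fun n => ?_
  rw [norm_smul, norm_inv, Real.norm_natCast, div_eq_inv_mul]
  gcongr
  rcases Nat.eq_zero_or_pos n with rfl | hn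
  · simpa using h1
  · exact norm_pow_le' x hn

/-- The semigroup generated by the Yosida approximation `m²R(m) - m`. -/
noncomputable def yosidaSemigroup (R : ℝ → B) (m r : ℝ) : B :=
  Real.exp (-(m * r)) • NormedSpace.exp (r • (m ^ 2 • R m))

theorem hasDerivAt_yosidaSemigroup [CompleteSpace B] (R : ℝ → B) (m r : ℝ) :
    HasDerivAt (yosidaSemigroup R m)
      (yosidaSemigroup R m r * (m ^ 2 • R m - m • 1)) r := by
  have he : HasDerivAt (fun t : ℝ => Real.exp (-(m * t))) (Real.exp (-(m * r)) * -(m * 1)) r :=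
    ((hasDerivAt_id r).const_mul m).neg.exp
  refine (he.smul (hasDerivAt_exp_smul_const (m ^ 2 • R m) r)).congr_deriv ?_
  simp only [yosidaSemigroup, mul_sub, smul_mul_assoc, mul_smul_comm, mul_one]
  module

theorem continuous_yosidaSemigroup [CompleteSpace B] (R : ℝ → B) (m : ℝ) :
    Continuous (yosidaSemigroup R m) :=
  continuous_iff_continuousAt.2 fun r => (hasDerivAt_yosidaSemigroup R m r).continuousAt

theorem norm_yosidaSemigroup_le (h1 : ‖(1 : B)‖ ≤ 1) {R : ℝ → B}
    (hb : ∀ l, 0 < l → ‖R l‖ ≤ l⁻¹) {m r : ℝ} (hm : 0 < m) (hr : 0 < r) :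
    ‖yosidaSemigroup R m r‖ ≤ 1 := by
  rw [yosidaSemigroup, norm_smul, Real.norm_eq_abs, Real.abs_exp]
  have hn : ‖r • (m ^ 2 • R m)‖ ≤ m * r := by
    rw [smul_smul, norm_smul, Real.norm_of_nonneg (by positivity)]
    calc r * m ^ 2 * ‖R m‖ ≤ r * m ^ 2 * m⁻¹ := by gcongr; exact hb m hm
      _ = m * r := by field_simp
  calc Real.exp (-(m * r)) * ‖NormedSpace.exp (r • (m ^ 2 • R m))‖
      ≤ Real.exp (-(m * r)) * Real.exp (m * r) := by
        gcongr
        exact (norm_exp_le_exp_norm h1 _).trans (Real.exp_le_exp.2 hn)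
    _ = 1 := by rw [← Real.exp_add]; simp

theorem laplace_yosidaSemigroup [CompleteSpace B] (h1 : ‖(1 : B)‖ ≤ 1) {R : ℝ → B}
    (hb : ∀ l, 0 < l → ‖R l‖ ≤ l⁻¹)
    (hres : ∀ l m, 0 < l → 0 < m → R l - R m = (m - l) • (R l * R m))
    {l m : ℝ} (hl : 0 < l) (hm : 0 < m) :
    ∫ r in Ioi (0 : ℝ), Real.exp (-(l * r)) • yosidaSemigroup R m r =
      (l + m)⁻¹ • (1 : B) + (m / (l + m)) ^ 2 • R (l * m / (l + m)) := by
  set q := yosidaSemigroup R m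
  set a : B := m ^ 2 • R m - m • 1
  have hqb : ∀ r, 0 < r → ‖q r‖ ≤ 1 * (1 + r) := fun r hr =>
    (norm_yosidaSemigroup_le h1 hb hm hr).trans (by linarith)
  have hi := integrableOn_exp_smul_of_linear_growth
    (continuous_yosidaSemigroup R m).aestronglyMeasurable zero_le_one hqb hl
  have hd : ∀ r ∈ Ici (0 : ℝ), HasDerivAt (fun r : ℝ => Real.exp (-(l * r)) • q r)
      ((Real.exp (-(l * r)) • q r) * (a - l • 1)) r := by
    intro r _
    have he : HasDerivAt (fun t : ℝ => Real.exp (-(l * t))) (Real.exp (-(l * r)) * -(l * 1)) r :=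
      ((hasDerivAt_id r).const_mul l).neg.exp
    refine (he.smul (hasDerivAt_yosidaSemigroup R m r)).congr_deriv ?_
    simp only [mul_sub, smul_mul_assoc, mul_smul_comm, mul_one, q, a]
    module
  have hleft := integral_Ioi_of_hasDerivAt_of_tendsto' hd (hi.mul_const _)
    (tendsto_exp_smul_of_linear_growth zero_le_one hqb hl)
  have hmul : ∫ r in Ioi (0 : ℝ), (Real.exp (-(l * r)) • q r) * (a - l • 1) =
      (∫ r in Ioi (0 : ℝ), Real.exp (-(l * r)) • q r) * (a - l • 1) :=
    ((ContinuousLinearMap.mul ℝ B).flip (a - l • 1)).integral_comp_comm hi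
  rw [hmul] at hleft
  have hq0 : q 0 = 1 := by simp [q, yosidaSemigroup]
  simp only [mul_zero, neg_zero, Real.exp_zero, one_smul, hq0, zero_sub] at hleft
  have hright : (a - l • 1) *
      ((l + m)⁻¹ • (1 : B) + (m / (l + m)) ^ 2 • R (l * m / (l + m))) = -1 := by
    have h := hres m (l * m / (l + m)) hm (by positivity)
    have hc : l * m / (l + m) - m = -(m ^ 2 / (l + m)) := by field_simp; ring
    rw [hc] at h
    have hR : R m = R (l * m / (l + m)) + -(m ^ 2 / (l + m)) • (R m * R (l * m / (l + m))) := by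
      rw [← h]; abel
    have hx : a - l • (1 : B) = m ^ 2 • R m - (l + m) • 1 := by
      simp only [a]; module
    rw [hx, sub_mul, mul_add, mul_add]
    simp only [smul_mul_assoc, mul_smul_comm, mul_one, one_mul]
    generalize R m * R (l * m / (l + m)) = P at *
    rw [hR]
    match_scalars <;> field_simp <;> ring
  calc _ = -((∫ r in Ioi (0 : ℝ), Real.exp (-(l * r)) • q r) * ((a - l • 1) *
        ((l + m)⁻¹ • (1 : B) + (m / (l + m)) ^ 2 • R (l * m / (l + m))))) := by
        rw [hright]; simp
    _ = _ := by rw [← mul_assoc, hleft]; simp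

theorem tendsto_laplace_yosidaSemigroup [CompleteSpace B] (h1 : ‖(1 : B)‖ ≤ 1) {R : ℝ → B}
    (hb : ∀ l, 0 < l → ‖R l‖ ≤ l⁻¹)
    (hres : ∀ l m, 0 < l → 0 < m → R l - R m = (m - l) • (R l * R m)) {l : ℝ} (hl : 0 < l) :
    Tendsto (fun n : ℕ => ∫ r in Ioi (0 : ℝ),
      Real.exp (-(l * r)) • yosidaSemigroup R ((n : ℝ) + 1) r) atTop (𝓝 (R l)) := by
  have hpos : ∀ n : ℕ, 0 < (n : ℝ) + 1 := fun n => by positivity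
  simp_rw [fun n : ℕ => laplace_yosidaSemigroup h1 hb hres hl (hpos n)]
  have hinf : Tendsto (fun n : ℕ => (n : ℝ) + 1) atTop atTop :=
    tendsto_atTop_add_const_right _ _ tendsto_natCast_atTop_atTop
  have hinv : Tendsto (fun n : ℕ => (l + ((n : ℝ) + 1))⁻¹) atTop (𝓝 0) :=
    (tendsto_atTop_add_const_left _ l hinf).inv_tendsto_atTop
  have hquot : Tendsto (fun n : ℕ => ((n : ℝ) + 1) / (l + ((n : ℝ) + 1))) atTop (𝓝 1) := by
    have : Tendsto (fun n : ℕ => 1 - l * (l + ((n : ℝ) + 1))⁻¹) atTop (𝓝 (1 - l * 0)) :=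
      tendsto_const_nhds.sub (hinv.const_mul l)
    rw [mul_zero, sub_zero] at this
    refine this.congr fun n => ?_
    have := hpos n
    field_simp; ring
  have hR : Tendsto (fun n : ℕ => R (l * ((n : ℝ) + 1) / (l + ((n : ℝ) + 1)))) atTop
      (𝓝 (R l)) := by
    rw [tendsto_iff_norm_sub_tendsto_zero]
    refine squeeze_zero (fun n => norm_nonneg _) (fun n => ?_) hinf.inv_tendsto_atTop
    have hn := hpos n
    have hν : 0 < l * ((n : ℝ) + 1) / (l + ((n : ℝ) + 1)) := by positivity
    have hd : 0 ≤ l - l * ((n : ℝ) + 1) / (l + ((n : ℝ) + 1)) := by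
      rw [sub_nonneg, div_le_iff₀ (by positivity)]
      nlinarith
    rw [hres _ _ hν hl, norm_smul, Real.norm_of_nonneg hd]
    calc _ ≤ (l - l * ((n : ℝ) + 1) / (l + ((n : ℝ) + 1))) *
          ((l * ((n : ℝ) + 1) / (l + ((n : ℝ) + 1)))⁻¹ * l⁻¹) := by
          gcongr
          exact (norm_mul_le _ _).trans (by gcongr; exacts [hb _ hν, hb _ hl])
      _ = ((n : ℝ) + 1)⁻¹ := by field_simp; ring
  simpa using (hinv.smul_const (1 : B)).add ((hquot.pow 2).smul hR)

/-- A contractive pseudo-resolvent is, up to the factor `l`, the Laplace transform of a Lipschitz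
function. -/
theorem exists_lipschitz_laplace_eq [CompleteSpace B] (h1 : ‖(1 : B)‖ ≤ 1) {R : ℝ → B}
    (hb : ∀ l, 0 < l → ‖R l‖ ≤ l⁻¹)
    (hres : ∀ l m, 0 < l → 0 < m → R l - R m = (m - l) • (R l * R m)) :
    ∃ S : ℝ → B, S 0 = 0 ∧ (∀ s t, ‖S t - S s‖ ≤ |t - s|) ∧
      ∀ l, 0 < l → R l = l • ∫ t in Ioi (0 : ℝ), Real.exp (-(l * t)) • S t := by
  set q : ℕ → ℝ → B := fun n => yosidaSemigroup R ((n : ℝ) + 1)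
  have hqc : ∀ n, Continuous (q n) := fun n => continuous_yosidaSemigroup R _
  have hqb : ∀ n r, 0 < r → ‖q n r‖ ≤ 1 := fun n r hr =>
    norm_yosidaSemigroup_le h1 hb (by positivity) hr
  have hqL := fun l (hl : 0 < l) => tendsto_laplace_yosidaSemigroup h1 hb hres hl
  set s : ℕ → ℝ → B := fun n t => ∫ r in (0 : ℝ)..max t 0, q n r
  have hex : ∀ t, ∃ y, Tendsto (fun n => s n t) atTop (𝓝 y) := by
    intro t
    have hc := cauchySeq_integral_smul_of_laplace (fun n => (hqc n).aestronglyMeasurable) hqb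
      (fun l hl => ⟨_, hqL l hl⟩) (integrable_indicator_Ioc_one (max t 0))
    simp_rw [integral_indicator_smul_Ioi _ (le_max_right t 0)] at hc
    exact cauchySeq_tendsto_of_complete hc
  choose S hS using hex
  have hsLip : ∀ n u t, ‖s n t - s n u‖ ≤ |t - u| := by
    intro n u t
    have hi : ∀ a b, IntervalIntegrable (q n) volume a b := fun a b =>
      (hqc n).intervalIntegrable a b
    simp only [s]
    rw [intervalIntegral.integral_interval_sub_left (hi _ _) (hi _ _)]
    have := intervalIntegral.norm_integral_le_of_norm_le_const (a := max u 0) (b := max t 0)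
      (f := q n) (C := 1) fun r hr => hqb n r <| by
        have := hr.1
        exact lt_of_le_of_lt (le_min (le_max_right _ _) (le_max_right _ _)) this
    rw [one_mul] at this
    exact this.trans (abs_max_sub_max_le_abs t u 0)
  have hs0 : ∀ n, s n 0 = 0 := fun n => by simp [s]
  refine ⟨S, ?_, ?_, ?_⟩
  · refine tendsto_nhds_unique (hS 0) ?_
    simp_rw [hs0]
    exact tendsto_const_nhds
  · exact fun u t => le_of_tendsto ((hS t).sub (hS u)).norm (Eventually.of_forall fun n =>
      hsLip n u t)
  · intro l hl
    have hsb : ∀ n t, 0 < t → ‖s n t‖ ≤ 1 * (1 + t) := fun n t ht => by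
      have := hsLip n 0 t
      rw [hs0, sub_zero, sub_zero, abs_of_pos ht] at this
      linarith
    have hsc : ∀ n, Continuous (s n) := fun n =>
      (LipschitzWith.of_dist_le_mul (K := 1) fun t u => by
        simpa [dist_eq_norm] using hsLip n u t).continuous
    have hlim : Tendsto (fun n => l • ∫ t in Ioi (0 : ℝ), Real.exp (-(l * t)) • s n t) atTop
        (𝓝 (l • ∫ t in Ioi (0 : ℝ), Real.exp (-(l * t)) • S t)) := by
      refine Tendsto.const_smul (tendsto_integral_of_dominated_convergence
        (fun t => 1 * (1 + 2 / l) * Real.exp (-(l / 2 * t))) (fun n => ?_)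
        ((integrableOn_exp_neg_mul_Ioi (half_pos hl)).const_mul _) (fun n => ?_)
        (ae_of_all _ fun t => (hS t).const_smul _)) l
      · exact ((by fun_prop : Continuous fun t : ℝ => Real.exp (-(l * t))).smul
          (hsc n)).aestronglyMeasurable
      · filter_upwards [ae_restrict_mem measurableSet_Ioi] with t ht
        exact norm_exp_smul_le_of_linear_growth zero_le_one ht (hsb n t ht) hl
    refine tendsto_nhds_unique (hqL l hl) (hlim.congr fun n => ?_)
    rw [← smul_laplace_primitive (hqc n) zero_le_one (hqb n) hl]
    congr 1
    refine setIntegral_congr_fun measurableSet_Ioi fun t ht => ?_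
    simp only [s]
    rw [max_eq_left (le_of_lt ht)]

end YosidaApproximation

section FunctionalEquation

open Set

theorem integral_exp_smul_comp_add {E : Type*} [NormedAddCommGroup E] [NormedSpace ℝ E]
    {h : ℝ → E} (hc : Continuous h) {C : ℝ} (hC : 0 ≤ C)
    (hb : ∀ r, 0 < r → ‖h r‖ ≤ C * (1 + r)) {l t : ℝ} (hl : 0 < l) (ht : 0 ≤ t) :
    ∫ r in Ioi (0 : ℝ), Real.exp (-(l * r)) • h (r + t) =
      Real.exp (l * t) • ((∫ r in Ioi (0 : ℝ), Real.exp (-(l * r)) • h r) -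
        ∫ r in (0 : ℝ)..t, Real.exp (-(l * r)) • h r) := by
  have hb' : ∀ r, 0 < r → ‖h (r + t)‖ ≤ C * (1 + t) * (1 + r) := fun r hr =>
    (hb (r + t) (by linarith)).trans <| by
      rw [mul_assoc]
      gcongr
      nlinarith
  have hi := integrableOn_exp_smul_of_linear_growth hc.aestronglyMeasurable hC hb hl
  have hi' := integrableOn_exp_smul_of_linear_growth
    (hc.comp (continuous_add_const t)).aestronglyMeasurable (by positivity) hb' hl
  have hec : Continuous fun r : ℝ => Real.exp (-(l * r)) • h r := by fun_prop
  have hfin : ∀ s : ℝ, ∫ r in (0 : ℝ)..s, Real.exp (-(l * r)) • h (r + t) =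
      Real.exp (l * t) • ((∫ r in (0 : ℝ)..(s + t), Real.exp (-(l * r)) • h r) -
        ∫ r in (0 : ℝ)..t, Real.exp (-(l * r)) • h r) := by
    intro s
    rw [intervalIntegral.integral_interval_sub_left (hec.intervalIntegrable _ _)
      (hec.intervalIntegrable _ _)]
    have := intervalIntegral.integral_comp_add_right (a := 0) (b := s)
      (fun r : ℝ => Real.exp (-(l * r)) • h r) t
    rw [zero_add] at this
    rw [← this, ← intervalIntegral.integral_smul]
    refine intervalIntegral.integral_congr fun r _ => ?_
    simp only [smul_smul, ← Real.exp_add]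
    ring_nf
  refine tendsto_nhds_unique (intervalIntegral_tendsto_integral_Ioi 0 hi' tendsto_id) ?_
  simp only [id, hfin]
  exact ((intervalIntegral_tendsto_integral_Ioi 0 hi
    (tendsto_atTop_add_const_right _ t tendsto_id)).sub_const _).const_smul _

variable {B : Type*} [NormedRing B] [NormedAlgebra ℝ B] [CompleteSpace B]

theorem mul_resolvent_eq_of_laplace_eq {R S : ℝ → B}
    (hres : ∀ l m, 0 < l → 0 < m → R l - R m = (m - l) • (R l * R m))
    (hS0 : S 0 = 0) (hS : ∀ s t, ‖S t - S s‖ ≤ |t - s|)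
    (hL : ∀ l, 0 < l → ∫ t in Ioi (0 : ℝ), Real.exp (-(l * t)) • S t = l⁻¹ • R l)
    {l t : ℝ} (hl : 0 < l) (ht : 0 ≤ t) :
    Real.exp (-(l * t)) • (S t * R l) + (l⁻¹ * Real.exp (-(l * t))) • R l +
      (∫ u in (0 : ℝ)..t, Real.exp (-(l * u)) • S u) - l⁻¹ • R l = 0 := by
  have hSc : Continuous S :=
    (LipschitzWith.of_dist_le_mul (K := 1) fun t u => by
      simpa [dist_eq_norm] using hS u t).continuous
  have hSb : ∀ t, 0 < t → ‖S t‖ ≤ t := fun t ht => by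
    simpa [hS0, abs_of_pos ht] using hS 0 t
  have hSb' : ∀ t, 0 < t → ‖S t‖ ≤ 1 * (1 + t) := fun t ht => (hSb t ht).trans (by linarith)
  have hec : Continuous fun u : ℝ => Real.exp (-(l * u)) • S u := by fun_prop
  have heb : ∀ u, 0 < u → ‖Real.exp (-(l * u)) • S u‖ ≤ l⁻¹ := fun u hu => by
    rw [norm_smul, Real.norm_eq_abs, Real.abs_exp]
    calc Real.exp (-(l * u)) * ‖S u‖ ≤ Real.exp (-(l * u)) * (l⁻¹ * Real.exp (l * u)) := by
          gcongr
          rw [← div_eq_inv_mul, le_div_iff₀ hl]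
          nlinarith [hSb u hu, Real.add_one_le_exp (l * u)]
      _ = l⁻¹ * (Real.exp (-(l * u)) * Real.exp (l * u)) := by ring
      _ = l⁻¹ := by rw [← Real.exp_add]; simp
  have hGc : Continuous fun t => ∫ u in (0 : ℝ)..t, Real.exp (-(l * u)) • S u :=
    intervalIntegral.continuous_primitive (fun a b => hec.intervalIntegrable a b) 0
  have hGb : ∀ t, 0 < t → ‖∫ u in (0 : ℝ)..t, Real.exp (-(l * u)) • S u‖ ≤ l⁻¹ * (1 + t) :=
    fun t ht => norm_primitive_le (by positivity) heb ht
  refine eq_zero_of_laplace_eq_zero (h := fun t => Real.exp (-(l * t)) • (S t * R l) +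
    (l⁻¹ * Real.exp (-(l * t))) • R l + (∫ u in (0 : ℝ)..t, Real.exp (-(l * u)) • S u) -
    l⁻¹ • R l) (by fun_prop) (C := ‖R l‖ + 2 * l⁻¹ * ‖R l‖ + l⁻¹) (by positivity) ?_ ?_ ht
  · intro t ht
    have he : Real.exp (-(l * t)) ≤ 1 := Real.exp_le_one_iff.2 (by nlinarith)
    have n1 : ‖Real.exp (-(l * t)) • (S t * R l)‖ ≤ t * ‖R l‖ := by
      rw [norm_smul, Real.norm_eq_abs, Real.abs_exp]
      calc _ ≤ 1 * (t * ‖R l‖) := by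
            gcongr
            exact (norm_mul_le _ _).trans (by gcongr; exact hSb t ht)
        _ = _ := one_mul _
    have n2 : ‖(l⁻¹ * Real.exp (-(l * t))) • R l‖ ≤ l⁻¹ * ‖R l‖ := by
      rw [norm_smul, Real.norm_of_nonneg (by positivity)]
      gcongr
      exact mul_le_of_le_one_right (by positivity) he
    have n3 : ‖l⁻¹ • R l‖ = l⁻¹ * ‖R l‖ := by
      rw [norm_smul, Real.norm_of_nonneg (by positivity)]
    have n4 : 0 ≤ ‖R l‖ + 2 * (l⁻¹ * ‖R l‖) * t := by positivity
    refine (norm_sub_le _ _).trans ?_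
    rw [n3]
    linarith [hGb t ht, norm_add₃_le (a := Real.exp (-(l * t)) • (S t * R l))
      (b := (l⁻¹ * Real.exp (-(l * t))) • R l)
      (c := ∫ u in (0 : ℝ)..t, Real.exp (-(l * u)) • S u)]
  · intro m hm
    have hlm : 0 < l + m := by positivity
    have i1 : IntegrableOn (fun t => Real.exp (-((l + m) * t)) • (S t * R l)) (Ioi 0) := by
      refine ((integrableOn_exp_smul_of_linear_growth hSc.aestronglyMeasurable zero_le_one hSb'
        hlm).mul_const (R l)).congr (ae_of_all _ fun t => ?_)
      simp only [smul_mul_assoc]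
    have v1 : ∫ t in Ioi (0 : ℝ), Real.exp (-((l + m) * t)) • (S t * R l) =
        (l + m)⁻¹ • (R (l + m) * R l) := by
      rw [← smul_mul_assoc, ← hL _ hlm]
      simp_rw [← smul_mul_assoc]
      exact ((ContinuousLinearMap.mul ℝ B).flip (R l)).integral_comp_comm
        (integrableOn_exp_smul_of_linear_growth hSc.aestronglyMeasurable zero_le_one hSb' hlm)
    have hconst : ∀ {c : ℝ}, 0 < c → ∀ b : B,
        IntegrableOn (fun t => Real.exp (-(c * t)) • b) (Ioi 0) := fun hc b =>
      (integrableOn_exp_neg_mul_Ioi hc).smul_const b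
    have hconst' : ∀ {c : ℝ}, 0 < c → ∀ b : B,
        ∫ t in Ioi (0 : ℝ), Real.exp (-(c * t)) • b = c⁻¹ • b := fun hc b => by
      rw [integral_smul_const, integral_exp_neg_mul_Ioi hc]
    have i3 := integrableOn_exp_smul_of_linear_growth hGc.aestronglyMeasurable
      (by positivity) hGb hm
    have v3 : ∫ t in Ioi (0 : ℝ), Real.exp (-(m * t)) •
        ∫ u in (0 : ℝ)..t, Real.exp (-(l * u)) • S u = m⁻¹ • (l + m)⁻¹ • R (l + m) := by
      rw [← hL _ hlm, eq_inv_smul_iff₀ hm.ne',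
        smul_laplace_primitive hec (by positivity) heb hm]
      refine setIntegral_congr_fun measurableSet_Ioi fun r _ => ?_
      simp only [smul_smul, ← Real.exp_add]
      ring_nf
    have i2 : IntegrableOn (fun t => Real.exp (-((l + m) * t)) • (l⁻¹ • R l)) (Ioi 0) :=
      hconst hlm _
    have i12 : IntegrableOn (fun t => Real.exp (-((l + m) * t)) • (S t * R l) +
        Real.exp (-((l + m) * t)) • (l⁻¹ • R l)) (Ioi 0) := i1.add i2
    have i123 : IntegrableOn (fun t => Real.exp (-((l + m) * t)) • (S t * R l) +
        Real.exp (-((l + m) * t)) • (l⁻¹ • R l) +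
        Real.exp (-(m * t)) • ∫ u in (0 : ℝ)..t, Real.exp (-(l * u)) • S u) (Ioi 0) := i12.add i3
    have hsplit : ∀ t, Real.exp (-(m * t)) • (Real.exp (-(l * t)) • (S t * R l) +
        (l⁻¹ * Real.exp (-(l * t))) • R l + (∫ u in (0 : ℝ)..t, Real.exp (-(l * u)) • S u) -
        l⁻¹ • R l) = Real.exp (-((l + m) * t)) • (S t * R l) +
        Real.exp (-((l + m) * t)) • (l⁻¹ • R l) +
        (Real.exp (-(m * t)) • ∫ u in (0 : ℝ)..t, Real.exp (-(l * u)) • S u) -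
        Real.exp (-(m * t)) • (l⁻¹ • R l) := by
      intro t
      have : Real.exp (-((l + m) * t)) = Real.exp (-(m * t)) * Real.exp (-(l * t)) := by
        rw [← Real.exp_add]; ring_nf
      rw [this]
      module
    simp_rw [hsplit]
    rw [integral_sub i123 (hconst hm _), integral_add i12 i3, integral_add i1 i2, v1, v3,
      hconst' hlm, hconst' hm]
    have h := hres (l + m) l hlm hl
    have hR : R (l + m) = R l + (l - (l + m)) • (R (l + m) * R l) := by rw [← h]; abel
    generalize R (l + m) * R l = P at *
    rw [hR]
    match_scalars <;> field_simp <;> ring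

/-- The functional equation of an integrated semigroup. -/
theorem mul_eq_integral_sub_of_laplace_eq {R S : ℝ → B}
    (hres : ∀ l m, 0 < l → 0 < m → R l - R m = (m - l) • (R l * R m))
    (hS0 : S 0 = 0) (hS : ∀ s t, ‖S t - S s‖ ≤ |t - s|)
    (hL : ∀ l, 0 < l → ∫ t in Ioi (0 : ℝ), Real.exp (-(l * t)) • S t = l⁻¹ • R l)
    {s t : ℝ} (hs : 0 ≤ s) (ht : 0 ≤ t) :
    S t * S s = (∫ r in t..(t + s), S r) - ∫ r in (0 : ℝ)..s, S r := by
  have hSc : Continuous S :=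
    (LipschitzWith.of_dist_le_mul (K := 1) fun t u => by
      simpa [dist_eq_norm] using hS u t).continuous
  have hSb : ∀ t, 0 ≤ t → ‖S t‖ ≤ t := fun t ht => by
    simpa [hS0, abs_of_nonneg ht] using hS 0 t
  have hSb' : ∀ t, 0 < t → ‖S t‖ ≤ 1 * (1 + t) := fun t ht =>
    (hSb t ht.le).trans (by linarith)
  have hgc : Continuous fun r => S (r + t) - S r := by fun_prop
  have hgb : ∀ r, 0 < r → ‖S (r + t) - S r‖ ≤ t := fun r _ => by
    simpa [abs_of_nonneg ht] using hS r (r + t)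
  have hGc : Continuous fun s => ∫ r in (0 : ℝ)..s, (S (r + t) - S r) :=
    intervalIntegral.continuous_primitive (fun a b => hgc.intervalIntegrable a b) 0
  have hGb : ∀ s, 0 < s → ‖∫ r in (0 : ℝ)..s, (S (r + t) - S r)‖ ≤ t * (1 + s) :=
    fun s hs => norm_primitive_le ht hgb hs
  have hpb : ∀ s, 0 < s → ‖S t * S s‖ ≤ t * (1 + s) := fun s hs =>
    (norm_mul_le _ _).trans (by gcongr; exacts [hSb t ht, (hSb s hs.le).trans (by linarith)])
  have key : S t * S s - ∫ r in (0 : ℝ)..s, (S (r + t) - S r) = 0 := by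
    refine eq_zero_of_laplace_eq_zero
      (h := fun s => S t * S s - ∫ r in (0 : ℝ)..s, (S (r + t) - S r)) (by fun_prop)
      (C := 2 * t) (by positivity) (fun s hs => ?_) (fun l hl => ?_) hs
    · exact (norm_sub_le _ _).trans (by linarith [hpb s hs, hGb s hs])
    · have hi := integrableOn_exp_smul_of_linear_growth hSc.aestronglyMeasurable zero_le_one
        hSb' hl
      have hb' : ∀ r, 0 < r → ‖S (r + t)‖ ≤ (1 + t) * (1 + r) := fun r hr =>
        (hSb (r + t) (by linarith)).trans (by nlinarith)
      have hi' : IntegrableOn (fun r => Real.exp (-(l * r)) • S (r + t)) (Ioi 0) :=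
        integrableOn_exp_smul_of_linear_growth
          (hSc.comp (continuous_add_const t)).aestronglyMeasurable (by positivity) hb' hl
      have v1 : ∫ s in Ioi (0 : ℝ), Real.exp (-(l * s)) • (S t * S s) =
          l⁻¹ • (S t * R l) := by
        rw [← mul_smul_comm, ← hL _ hl]
        simp_rw [← mul_smul_comm]
        exact (ContinuousLinearMap.mul ℝ B (S t)).integral_comp_comm hi
      have v2 : ∫ s in Ioi (0 : ℝ), Real.exp (-(l * s)) •
          ∫ r in (0 : ℝ)..s, (S (r + t) - S r) = l⁻¹ • (S t * R l) := by
        rw [eq_inv_smul_iff₀ hl.ne', smul_laplace_primitive hgc ht hgb hl]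
        simp_rw [smul_sub]
        have e1 := integral_exp_smul_comp_add hSc zero_le_one hSb' hl ht
        have e2 := mul_resolvent_eq_of_laplace_eq hres hS0 hS hL hl ht
        have e3 : ∫ u in (0 : ℝ)..t, Real.exp (-(l * u)) • S u = l⁻¹ • R l -
            (Real.exp (-(l * t)) • (S t * R l) + (l⁻¹ * Real.exp (-(l * t))) • R l) := by
          rw [← sub_eq_zero, ← e2]; abel
        have hexp : Real.exp (l * t) * Real.exp (-(l * t)) = 1 := by
          rw [← Real.exp_add]; simp
        rw [integral_sub hi' hi, e1, e3, hL l hl, sub_sub_cancel, smul_add, smul_smul, smul_smul, hexp,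
          mul_left_comm, hexp, mul_one, one_smul, add_sub_cancel_right]
      simp_rw [smul_sub (Real.exp _)]
      rw [integral_sub (integrableOn_exp_smul_of_linear_growth
        (by fun_prop : Continuous fun s => S t * S s).aestronglyMeasurable ht hpb hl)
        (integrableOn_exp_smul_of_linear_growth hGc.aestronglyMeasurable ht hGb hl), v1, v2,
        sub_self]
  have hshift := intervalIntegral.integral_comp_add_right (a := 0) (b := s) S t
  rw [zero_add, add_comm s t] at hshift
  rw [sub_eq_zero.1 key, intervalIntegral.integral_sub
    ((by fun_prop : Continuous fun r => S (r + t)).intervalIntegrable _ _)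
    (hSc.intervalIntegrable _ _), hshift]

end FunctionalEquation

section Resolvent

variable {𝕜 X : Type*} [RCLike 𝕜] [NormedAddCommGroup X] [NormedSpace 𝕜 X]

theorem IsResolventOf.norm_le_inv {A : Submodule 𝕜 (X × X)} (hA : Dissipative A) {l : ℝ}
    (hl : 0 < l) {Q : X →L[𝕜] X} (hQ : IsResolventOf A (l : 𝕜) Q) : ‖Q‖ ≤ l⁻¹ := by
  refine Q.opNorm_le_bound (by positivity) fun u => ?_
  obtain ⟨y, hy, hu⟩ := (hQ u (Q u)).2 rfl
  have h := hA _ hy l hl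
  rw [← hu, norm_smul, RCLike.norm_ofReal, abs_of_pos hl] at h
  rwa [← div_eq_inv_mul, le_div_iff₀ hl, mul_comm]

theorem IsResolventOf.sub_eq {A : Submodule 𝕜 (X × X)} {l m : 𝕜} {P Q : X →L[𝕜] X}
    (hP : IsResolventOf A l P) (hQ : IsResolventOf A m Q) : P - Q = (m - l) • (P * Q) := by
  ext u
  obtain ⟨y, hy, hu⟩ := (hQ u (Q u)).2 rfl
  have h := (hP (l • Q u - y) (Q u)).1 ⟨y, hy, rfl⟩
  have hv : l • Q u - y = u + (l - m) • Q u := by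
    nth_rewrite 2 [hu]
    module
  rw [hv, map_add, map_smul] at h
  have hPu : P u = Q u - (l - m) • P (Q u) := eq_sub_of_add_eq h.symm
  change P u - Q u = (m - l) • P (Q u)
  rw [hPu]
  module

end Resolvent

/-- Generation theorem for integrated semigroups: an m-dissipative relation `A` generates a
unique integrated semigroup `S : [0,∞) → ℒ(X)`, i.e. (a) `S(0) = 0`,
(b) `‖S(t) - S(s)‖ ≤ |t - s|` for `s,t ≥ 0`, (c) `R(l,A)x = l ∫₀^∞ e^{-lt} S(t)x dt` for
`l > 0`; moreover `S` satisfies the functional equation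
(d) `S(t)S(s)x = ∫_t^{t+s} S(r)x dr - ∫₀^s S(r)x dr`. -/
theorem stmt_17 {𝕜 X : Type*} [RCLike 𝕜] [NormedAddCommGroup X] [NormedSpace 𝕜 X]
    [NormedSpace ℝ X] [IsScalarTower ℝ 𝕜 X]
    [CompleteSpace X] (A : Submodule 𝕜 (X × X))
    (hdiss : Dissipative A)
    (hm : ∃ l : ℝ, 0 < l ∧ ∀ v : X, ∃ p ∈ A, v = (l : 𝕜) • p.1 - p.2)
    (R : ℝ → X →L[𝕜] X) (hR : ∀ l : ℝ, 0 < l → IsResolventOf A (l : 𝕜) (R l)) :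
    ∃ S : ℝ → X →L[𝕜] X,
      -- (a)
      S 0 = 0 ∧
      -- (b)
      (∀ s t : ℝ, 0 ≤ s → 0 ≤ t → ‖S t - S s‖ ≤ |t - s|) ∧
      -- (c)
      (∀ l : ℝ, 0 < l → ∀ x : X,
        R l x = (l : 𝕜) • ∫ t in Set.Ioi (0 : ℝ), Real.exp (-(l * t)) • S t x) ∧
      -- (d)
      (∀ s t : ℝ, 0 ≤ s → 0 ≤ t → ∀ x : X,
        S t (S s x) = (∫ r in t..(t + s), S r x) - ∫ r in (0 : ℝ)..s, S r x) ∧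
      -- uniqueness: any function satisfying (a), (b), (c) agrees with S on [0,∞)
      (∀ S' : ℝ → X →L[𝕜] X,
        S' 0 = 0 →
        (∀ s t : ℝ, 0 ≤ s → 0 ≤ t → ‖S' t - S' s‖ ≤ |t - s|) →
        (∀ l : ℝ, 0 < l → ∀ x : X,
          R l x = (l : 𝕜) • ∫ t in Set.Ioi (0 : ℝ), Real.exp (-(l * t)) • S' t x) →
        ∀ t : ℝ, 0 ≤ t → S' t = S t) := by
  have hnorm : ∀ l, 0 < l → ‖R l‖ ≤ l⁻¹ := fun l hl => (hR l hl).norm_le_inv hdiss hl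
  let _ : NormedAlgebra ℝ (X →L[𝕜] X) := { norm_smul_le := norm_smul_le }
  have hres : ∀ l m, 0 < l → 0 < m → R l - R m = (m - l) • (R l * R m) := by
    intro l m hl hm
    rw [(hR l hl).sub_eq (hR m hm)]
    ext u
    simp [RCLike.real_smul_eq_coe_smul (K := 𝕜)]
  obtain ⟨S, hS0, hS, hL⟩ :=
    exists_lipschitz_laplace_eq ContinuousLinearMap.norm_id_le hnorm hres
  have hL' : ∀ l, 0 < l →
      ∫ t in Set.Ioi (0 : ℝ), Real.exp (-(l * t)) • S t = l⁻¹ • R l := fun l hl => by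
    rw [hL l hl, inv_smul_smul₀ hl.ne']
  have hSc : Continuous S :=
    (LipschitzWith.of_dist_le_mul (K := 1) fun t u => by
      simpa [dist_eq_norm] using hS u t).continuous
  have hSb : ∀ t, 0 < t → ‖S t‖ ≤ 1 * (1 + t) := fun t ht => by
    have : ‖S t‖ ≤ t := by simpa [hS0, abs_of_pos ht] using hS 0 t
    linarith
  have hSi : ∀ l : ℝ, 0 < l →
      IntegrableOn (fun t => Real.exp (-(l * t)) • S t) (Set.Ioi 0) := fun l hl =>
    integrableOn_exp_smul_of_linear_growth hSc.aestronglyMeasurable zero_le_one hSb hl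
  have hLx : ∀ l : ℝ, 0 < l → ∀ x : X,
      R l x = (l : 𝕜) • ∫ t in Set.Ioi (0 : ℝ), Real.exp (-(l * t)) • S t x := by
    intro l hl x
    rw [← RCLike.real_smul_eq_coe_smul]
    nth_rewrite 1 [hL l hl]
    rw [smul_apply, ContinuousLinearMap.integral_apply (hSi l hl)]
    rfl
  refine ⟨S, hS0, fun s t _ _ => hS s t, hLx, fun s t hs ht x => ?_, ?_⟩
  · have h := congrArg (fun T : X →L[𝕜] X => T x)
      (mul_eq_integral_sub_of_laplace_eq hres hS0 hS hL' hs ht)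
    simp only [mul_apply_eq_comp, sub_apply] at h
    rwa [ContinuousLinearMap.intervalIntegral_apply (hSc.intervalIntegrable _ _),
      ContinuousLinearMap.intervalIntegral_apply (hSc.intervalIntegrable _ _)] at h
  · intro S' hS'0 hS' hL'x t ht
    ext x
    have hmc : Continuous fun t : ℝ => S' (max t 0) :=
      (LipschitzWith.of_dist_le_mul (K := 1) fun t u => by
        simpa [dist_eq_norm] using (hS' (max u 0) (max t 0) (le_max_right _ _)
          (le_max_right _ _)).trans (abs_max_sub_max_le_abs t u 0)).continuous
    have hm' : Continuous fun t : ℝ => S' (max t 0) x := hmc.clm_apply continuous_const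
    have hm : Continuous fun t : ℝ => S t x := hSc.clm_apply continuous_const
    have hb' : ∀ t, 0 < t → ‖S' (max t 0) x‖ ≤ ‖x‖ * (1 + t) := fun t ht => by
      have h1 : ‖S' t‖ ≤ t := by simpa [hS'0, abs_of_pos ht] using hS' 0 t le_rfl ht.le
      rw [max_eq_left ht.le, mul_comm]
      exact (S' t).le_of_opNorm_le (by linarith) x
    have hb : ∀ t, 0 < t → ‖S t x‖ ≤ ‖x‖ * (1 + t) := fun t ht => by
      rw [mul_comm]
      exact (S t).le_of_opNorm_le (by linarith [hSb t ht]) x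
    have h := eq_zero_of_laplace_eq_zero (h := fun t => S' (max t 0) x - S t x) (hm'.sub hm)
      (C := 2 * ‖x‖) (by positivity)
      (fun t ht => (norm_sub_le _ _).trans (by linarith [hb t ht, hb' t ht]))
      (fun l hl => ?_) ht
    · rwa [max_eq_left ht, sub_eq_zero] at h
    · simp_rw [smul_sub]
      rw [integral_sub
        (integrableOn_exp_smul_of_linear_growth hm'.aestronglyMeasurable (norm_nonneg x) hb' hl)
        (integrableOn_exp_smul_of_linear_growth hm.aestronglyMeasurable (norm_nonneg x) hb hl),
        sub_eq_zero]
      have hl' : (l : 𝕜) ≠ 0 := by exact_mod_cast hl.ne'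
      refine Eq.trans ?_ (smul_right_injective X hl' ((hL'x l hl x).symm.trans (hLx l hl x)))
      refine setIntegral_congr_fun measurableSet_Ioi fun r hr => ?_
      simp only [max_eq_left (le_of_lt (Set.mem_Ioi.1 hr))]
end

section
/- (Maximum principle for the distributional Laplacian.) Let U ⊆ ℝ^d be an open set, x₀ ∈ U, and let u, f : U → ℝ be continuous functions such that Δu = f in the sense of distributions on U, i.e. ∫_U u(x) Δφ(x) dx = ∫_U f(x) φ(x) dx for every smooth compactly supported function φ : U → ℝ. If u(x₀) = sup_{x ∈ U} u(x), then f(x₀) ≤ 0. -/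
open Filter Topology MeasureTheory

/-- The Laplacian `Δφ = Σᵢ ∂²φ/∂xᵢ²` of a function `φ : ℝ^d → ℝ`. -/
noncomputable def lap {d : ℕ} (φ : EuclideanSpace ℝ (Fin d) → ℝ)
    (x : EuclideanSpace ℝ (Fin d)) : ℝ :=
  ∑ i : Fin d,
    fderiv ℝ (fun y => fderiv ℝ φ y (EuclideanSpace.single i 1)) x (EuclideanSpace.single i 1)

open scoped Convolution

theorem fderiv_convolution_apply_left {E : Type*} [NormedAddCommGroup E] [NormedSpace ℝ E]
    [MeasurableSpace E] [BorelSpace E] {μ : Measure E} [SFinite μ] [μ.IsAddLeftInvariant]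
    [μ.IsNegInvariant] {ρ g : E → ℝ} (hρ : ContDiff ℝ 1 ρ) (hρc : HasCompactSupport ρ)
    (hg : LocallyIntegrable g μ) (y e : E) :
    fderiv ℝ (ρ ⋆[ContinuousLinearMap.lsmul ℝ ℝ, μ] g) y e =
      ((fun z => fderiv ℝ ρ z e) ⋆[ContinuousLinearMap.lsmul ℝ ℝ, μ] g) y := by
  rw [(hρc.hasFDerivAt_convolution_left _ hρ hg y).fderiv]
  have h := (hρc.fderiv ℝ).convolutionExists_left
    ((ContinuousLinearMap.lsmul ℝ ℝ : ℝ →L[ℝ] ℝ →L[ℝ] ℝ).precompL E)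
    (hρ.continuous_fderiv one_ne_zero) hg y
  simp only [convolution]
  rw [ContinuousLinearMap.integral_apply h]
  rfl

theorem ContDiff.fderiv_apply_const {E : Type*} [NormedAddCommGroup E] [NormedSpace ℝ E]
    {ρ : E → ℝ} (hρ : ContDiff ℝ (⊤ : ℕ∞) ρ) (e : E) :
    ContDiff ℝ (⊤ : ℕ∞) fun z => fderiv ℝ ρ z e :=
  (hρ.fderiv_right (m := (⊤ : ℕ∞)) (by simp)).clm_apply contDiff_const

theorem lap_convolution_left {d : ℕ} {ρ g : EuclideanSpace ℝ (Fin d) → ℝ}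
    (hρ : ContDiff ℝ (⊤ : ℕ∞) ρ) (hρc : HasCompactSupport ρ) (hg : LocallyIntegrable g)
    (y : EuclideanSpace ℝ (Fin d)) :
    lap (ρ ⋆[ContinuousLinearMap.lsmul ℝ ℝ, volume] g) y = ∫ x, g x * lap ρ (y - x) := by
  have key (i : Fin d) : fderiv ℝ (fun z => fderiv ℝ (ρ ⋆[ContinuousLinearMap.lsmul ℝ ℝ, volume] g) z
      (EuclideanSpace.single i 1)) y (EuclideanSpace.single i 1) =
      ((fun z => fderiv ℝ (fun w => fderiv ℝ ρ w (EuclideanSpace.single i 1)) z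
        (EuclideanSpace.single i 1)) ⋆[ContinuousLinearMap.lsmul ℝ ℝ, volume] g) y := by
    rw [← fderiv_convolution_apply_left ((hρ.fderiv_apply_const _).of_le (by simp))
      (hρc.fderiv_apply ℝ _) hg]
    congr 2
    ext z
    exact fderiv_convolution_apply_left (hρ.of_le (by simp)) hρc hg _ _
  simp only [lap, key, convolution_eq_swap, ContinuousLinearMap.lsmul_apply, smul_eq_mul,
    Finset.mul_sum]
  rw [integral_finsetSum]
  · simp only [mul_comm]
  · intro i _
    have := ((hρc.fderiv_apply ℝ (EuclideanSpace.single i 1)).fderiv_apply ℝ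
      (EuclideanSpace.single i 1)).convolutionExists_left (ContinuousLinearMap.lsmul ℝ ℝ)
      ((hρ.fderiv_apply_const _).fderiv_apply_const _).continuous hg y
    simpa [mul_comm] using this.integrable_swap

theorem lap_comp_const_sub {d : ℕ} (ρ : EuclideanSpace ℝ (Fin d) → ℝ)
    (y x : EuclideanSpace ℝ (Fin d)) :
    lap (fun z => ρ (y - z)) x = lap ρ (y - x) := by
  have key (h : EuclideanSpace ℝ (Fin d) → ℝ) (z e : EuclideanSpace ℝ (Fin d)) :
      fderiv ℝ (fun w => h (y - w)) z e = - fderiv ℝ h (y - z) e := by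
    have h1 := fderiv_comp_sub (𝕜 := ℝ) (f := fun w => h (-w)) y (x := z)
    have h2 := (ContinuousLinearEquiv.neg ℝ).comp_right_fderiv (f := h) (x := z - y)
    simp only [neg_sub] at h1
    rw [h1]
    simpa [Function.comp_def] using congrArg (fun L => L e) h2
  refine Finset.sum_congr rfl fun i _ => ?_
  simp only [key ρ, fderiv_fun_neg, neg_apply]
  rw [key (fun w => fderiv ℝ ρ w (EuclideanSpace.single i 1)), neg_neg]

theorem IsLocalMax.deriv_deriv_nonpos {k : ℝ → ℝ} {a : ℝ} (h : IsLocalMax k a)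
    (hc : ContinuousAt k a) : deriv (deriv k) a ≤ 0 := by
  by_contra! hpos
  have hmin := isLocalMin_of_deriv_deriv_pos hpos h.deriv_eq_zero hc
  have hconst : k =ᶠ[𝓝 a] fun _ => k a := by
    filter_upwards [h, hmin] with x h1 h2 using le_antisymm h1 h2
  have := hconst.deriv.deriv_eq
  simp at this
  exact hpos.ne' this

theorem IsLocalMax.fderiv_fderiv_apply_nonpos {E : Type*} [NormedAddCommGroup E] [NormedSpace ℝ E]
    {v : E → ℝ} {y : E} (h : IsLocalMax v y) (hv : ContDiff ℝ (⊤ : ℕ∞) v) (e : E) :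
    fderiv ℝ (fun z => fderiv ℝ v z e) y e ≤ 0 := by
  have hline (t : ℝ) : HasDerivAt (fun s : ℝ => y + s • e) e t := by
    simpa using ((hasDerivAt_id t).smul_const e).const_add y
  have hcomp {w : E → ℝ} (hw : ContDiff ℝ (⊤ : ℕ∞) w) (t : ℝ) :
      deriv (fun s : ℝ => w (y + s • e)) t = fderiv ℝ w (y + t • e) e :=
    ((hw.differentiable (by simp) _).hasFDerivAt.comp_hasDerivAt t (hline t)).deriv
  have hcont : ContinuousAt (fun s : ℝ => y + s • e) 0 := (hline 0).continuousAt
  have hmax : IsLocalMax (fun s : ℝ => v (y + s • e)) 0 := by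
    have : Tendsto (fun s : ℝ => y + s • e) (𝓝 0) (𝓝 y) := by simpa using hcont.tendsto
    simpa [IsLocalMax, IsMaxFilter] using this.eventually h
  have h2 := hmax.deriv_deriv_nonpos (hv.continuous.continuousAt.comp hcont)
  rw [funext (hcomp hv), hcomp (hv.fderiv_apply_const e)] at h2
  simpa using h2

theorem lap_le_of_isLocalMax_sub_norm_sq {d : ℕ} {H : EuclideanSpace ℝ (Fin d) → ℝ}
    (hH : ContDiff ℝ (⊤ : ℕ∞) H) {c : ℝ} {a y : EuclideanSpace ℝ (Fin d)}
    (h : IsLocalMax (fun z => H z - c * ‖z - a‖ ^ 2) y) : lap H y ≤ 2 * c * d := by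
  have hq : ContDiff ℝ (⊤ : ℕ∞) fun z : EuclideanSpace ℝ (Fin d) => c * ‖z - a‖ ^ 2 :=
    contDiff_const.mul ((contDiff_id.sub contDiff_const).norm_sq ℝ)
  have key (i : Fin d) : fderiv ℝ (fun z => fderiv ℝ H z (EuclideanSpace.single i 1)) y
      (EuclideanSpace.single i 1) ≤ 2 * c := by
    have h1 := h.fderiv_fderiv_apply_nonpos (hH.sub hq) (EuclideanSpace.single i 1)
    have h2 : (fun z => fderiv ℝ (fun z => H z - c * ‖z - a‖ ^ 2) z (EuclideanSpace.single i 1)) =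
        fun z => fderiv ℝ H z (EuclideanSpace.single i 1) -
          2 * c * inner ℝ (EuclideanSpace.single i 1) (z - a) := by
      ext z
      have h3 := (((hasFDerivAt_id (𝕜 := ℝ) z).sub_const a).norm_sq.const_mul c)
      have h4 := (hH.differentiable (by simp) z).hasFDerivAt.sub h3
      erw [h4.fderiv]
      simp [real_inner_comm (z - a), inner_sub_left]
      ring
    rw [h2] at h1
    have h5 : HasFDerivAt (fun z => 2 * c * inner ℝ (EuclideanSpace.single i (1 : ℝ)) (z - a))
        ((2 * c) • innerSL ℝ (EuclideanSpace.single i (1 : ℝ))) y :=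
      (((innerSL ℝ (EuclideanSpace.single i (1 : ℝ))).hasFDerivAt.comp y
        ((hasFDerivAt_id (𝕜 := ℝ) y).sub_const a)).const_mul (2 * c))
    have h6 := ((hH.fderiv_apply_const (EuclideanSpace.single i 1)).differentiable
      (by simp) y).hasFDerivAt.sub h5
    erw [h6.fderiv] at h1
    simpa using h1
  calc lap H y ≤ ∑ _i : Fin d, 2 * c := Finset.sum_le_sum fun i _ => key i
    _ = 2 * c * d := by simp [mul_comm]

/-- Maximum principle for the distributional Laplacian: let `U ⊆ ℝ^d` be open, `x₀ ∈ U`,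
and let `u, f` be continuous on `U` with `Δu = f` in the sense of distributions on `U`
(i.e. `∫_U u Δφ = ∫_U f φ` for all test functions `φ` on `U`). If
`u(x₀) = sup_{x ∈ U} u(x)`, then `f(x₀) ≤ 0`. -/
theorem stmt_19 {d : ℕ} (U : Set (EuclideanSpace ℝ (Fin d))) (hU : IsOpen U)
    (x₀ : EuclideanSpace ℝ (Fin d)) (hx₀ : x₀ ∈ U)
    (u f : EuclideanSpace ℝ (Fin d) → ℝ)
    (hu : ContinuousOn u U) (hf : ContinuousOn f U)
    (hdist : ∀ φ : EuclideanSpace ℝ (Fin d) → ℝ,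
      ContDiff ℝ (⊤ : ℕ∞) φ → HasCompactSupport φ → tsupport φ ⊆ U →
      ∫ x in U, u x * lap φ x = ∫ x in U, f x * φ x)
    (hmax : ∀ x ∈ U, u x ≤ u x₀) :
    f x₀ ≤ 0 := by
  by_contra! hpos
  obtain ⟨R, hR, hRU⟩ : ∃ R > 0, Metric.closedBall x₀ R ⊆ U ∩ {x | f x₀ / 2 ≤ f x} := by
    refine Metric.nhds_basis_closedBall.mem_iff.1 (inter_mem (hU.mem_nhds hx₀) ?_)
    exact (hf.continuousAt (hU.mem_nhds hx₀)).eventually_const_le (by linarith)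
  set K := Metric.closedBall x₀ R with hK
  have hKU : K ⊆ U := fun x hx => (hRU hx).1
  have hKf : ∀ x ∈ K, f x₀ / 2 ≤ f x := fun x hx => (hRU hx).2
  have hKc : IsCompact K := isCompact_closedBall _ _
  have hKm : MeasurableSet K := hKc.measurableSet
  obtain ⟨r, hr⟩ : ∃ r, r = R / 2 := ⟨_, rfl⟩
  obtain ⟨b, hb⟩ : ∃ b, b = f x₀ / (8 * (d + 1)) := ⟨_, rfl⟩
  have hbpos : 0 < b := by rw [hb]; positivity
  have hbd : 2 * b * d < f x₀ / 2 := by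
    have : b * (8 * (d + 1)) = f x₀ := by rw [hb]; field_simp
    nlinarith
  have hrpos : 0 < r := by linarith
  obtain ⟨ε, hε, hεu⟩ : ∃ ε > 0, Metric.ball x₀ ε ⊆ {x | dist (u x) (u x₀) ≤ b * r ^ 2 / 2} := by
    refine Metric.nhds_basis_ball.mem_iff.1 ?_
    exact (hu.continuousAt (hU.mem_nhds hx₀)).eventually
      (Metric.closedBall_mem_nhds _ (by positivity))
  obtain ⟨δ, hδ⟩ : ∃ δ, δ = min ε r := ⟨_, rfl⟩
  have hδpos : 0 < δ := by rw [hδ]; positivity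
  have hδε : δ ≤ ε := hδ ▸ min_le_left _ _
  have hδr : δ ≤ r := hδ ▸ min_le_right _ _
  let B : ContDiffBump (0 : EuclideanSpace ℝ (Fin d)) := ⟨δ / 2, δ, by positivity, by linarith⟩
  set ρ := B.normed volume with hρ
  have hρd : ContDiff ℝ (⊤ : ℕ∞) ρ := B.contDiff_normed
  have hρc : HasCompactSupport ρ := B.hasCompactSupport_normed
  have hρ0 (x) : 0 ≤ ρ x := B.nonneg_normed x
  have hρ1 : ∫ x, ρ x = 1 := B.integral_normed
  have hρi : Integrable ρ := hρd.continuous.integrable_of_hasCompactSupport hρc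
  have hρt : tsupport ρ = Metric.closedBall 0 δ := B.tsupport_normed_eq
  have hρs (x) (hx : δ < ‖x‖) : ρ x = 0 := by
    refine image_eq_zero_of_notMem_tsupport ?_
    rw [hρt]
    simpa using hx
  set g := K.indicator u with hg
  have hgi : Integrable g := ((hu.mono hKU).integrableOn_compact hKc).integrable_indicator hKm
  have hgl : LocallyIntegrable g := hgi.locallyIntegrable
  have hgx : ∀ x ∈ K, g x = u x := fun x hx => Set.indicator_of_mem hx u
  have hx₀K : x₀ ∈ K := Metric.mem_closedBall_self hR.le
  set H := ρ ⋆[ContinuousLinearMap.lsmul ℝ ℝ, volume] g with hH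
  have hHd : ContDiff ℝ (⊤ : ℕ∞) H := hρc.contDiff_convolution_left _ hρd hgl
  have hH₀ : u x₀ - b * r ^ 2 / 2 ≤ H x₀ := by
    have := B.dist_normed_convolution_le (μ := volume) (g := g) (x₀ := x₀) (ε := b * r ^ 2 / 2)
      hgi.aestronglyMeasurable (fun x hx => by
        have hx' : dist x x₀ < δ := hx
        rw [hgx x (by rw [hK, Metric.mem_closedBall]; linarith), hgx x₀ hx₀K]
        exact hεu (Metric.mem_ball.2 (hx'.trans_le hδε)))
    rw [hgx x₀ hx₀K, Real.dist_eq] at this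
    linarith [(abs_le.1 this).1]
  have hmemK {x y : EuclideanSpace ℝ (Fin d)} (hy : y ∈ Metric.closedBall x₀ r)
      (hx : ‖y - x‖ ≤ δ) : x ∈ K := by
    rw [Metric.mem_closedBall] at hy ⊢
    have := dist_triangle x y x₀
    rw [dist_comm x y, dist_eq_norm y x] at this
    linarith
  have hHle : ∀ y ∈ Metric.closedBall x₀ r, H y ≤ u x₀ := by
    intro y hy
    calc H y ≤ ∫ t, ρ t * u x₀ := by
          refine integral_mono (hρc.convolutionExists_left _ hρd.continuous hgl y)
            (hρi.mul_const _) fun t => ?_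
          simp only [ContinuousLinearMap.lsmul_apply, smul_eq_mul]
          rcases le_or_gt ‖t‖ δ with ht | ht
          · have : y - t ∈ K := hmemK hy (by simpa using ht)
            rw [hgx _ this]
            exact mul_le_mul_of_nonneg_left (hmax _ (hKU this)) (hρ0 t)
          · simp [hρs t ht]
      _ = u x₀ := by rw [integral_mul_const, hρ1, one_mul]
  have hlap : ∀ y ∈ Metric.closedBall x₀ r, f x₀ / 2 ≤ lap H y := by
    intro y hy
    have hφd : ContDiff ℝ (⊤ : ℕ∞) fun x => ρ (y - x) := hρd.comp (contDiff_const.sub contDiff_id)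
    have hφK : tsupport (fun x => ρ (y - x)) ⊆ K := by
      refine closure_minimal (fun x hx => hmemK hy ?_) hKc.isClosed
      by_contra! h
      exact hx (hρs _ h)
    have hφ0 (x) (hx : x ∉ K) : ρ (y - x) = 0 :=
      image_eq_zero_of_notMem_tsupport (f := fun x => ρ (y - x)) fun h => hx (hφK h)
    have hφc : HasCompactSupport fun x => ρ (y - x) := hKc.of_isClosed_subset isClosed_closure hφK
    have hlap0 (x) (hx : x ∉ K) : lap (fun x => ρ (y - x)) x = 0 := by
      refine Finset.sum_eq_zero fun i _ => ?_
      have : x ∉ tsupport fun z => fderiv ℝ (fun w => fderiv ℝ (fun x => ρ (y - x)) w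
          (EuclideanSpace.single i 1)) z (EuclideanSpace.single i 1) := fun h =>
        hx (hφK (tsupport_fderiv_apply_subset ℝ _ (tsupport_fderiv_apply_subset ℝ _ h)))
      exact image_eq_zero_of_notMem_tsupport (f := fun z => fderiv ℝ (fun w =>
        fderiv ℝ (fun x => ρ (y - x)) w (EuclideanSpace.single i 1)) z
          (EuclideanSpace.single i 1)) this
    calc f x₀ / 2 = f x₀ / 2 * ∫ x, ρ (y - x) := by
          rw [integral_sub_left_eq_self, hρ1, mul_one]
      _ = ∫ x in K, f x₀ / 2 * ρ (y - x) := by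
          rw [setIntegral_eq_integral_of_forall_compl_eq_zero fun x hx => by simp [hφ0 x hx],
            integral_const_mul]
      _ ≤ ∫ x in K, f x * ρ (y - x) := by
          refine setIntegral_mono_on ?_ ?_ hKm fun x hx =>
            mul_le_mul_of_nonneg_right (hKf x hx) (hρ0 _)
          · exact (continuous_const.mul hφd.continuous).continuousOn.integrableOn_compact hKc
          · exact ((hf.mono hKU).mul hφd.continuous.continuousOn).integrableOn_compact hKc
      _ = ∫ x in U, f x * ρ (y - x) :=
          (setIntegral_eq_of_subset_of_forall_sdiff_eq_zero hU.measurableSet hKU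
            fun x hx => by simp [hφ0 x hx.2]).symm
      _ = ∫ x in U, u x * lap (fun x => ρ (y - x)) x := (hdist _ hφd hφc (hφK.trans hKU)).symm
      _ = ∫ x in K, u x * lap (fun x => ρ (y - x)) x :=
          setIntegral_eq_of_subset_of_forall_sdiff_eq_zero hU.measurableSet hKU
            fun x hx => by simp [hlap0 x hx.2]
      _ = ∫ x, g x * lap ρ (y - x) := by
          rw [← integral_indicator hKm]
          refine integral_congr_ae (Eventually.of_forall fun x => ?_)
          by_cases hx : x ∈ K <;> simp [hg, hx, lap_comp_const_sub]
      _ = lap H y := (lap_convolution_left hρd hρc hgl y).symm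
  obtain ⟨y, hy, hymax⟩ := (isCompact_closedBall x₀ r).exists_isMaxOn
    ⟨x₀, Metric.mem_closedBall_self hrpos.le⟩
    (f := fun z => H z - b * ‖z - x₀‖ ^ 2)
    (hHd.continuous.sub (by fun_prop)).continuousOn
  have hylt : ‖y - x₀‖ < r := by
    have h1 := hymax (Metric.mem_closedBall_self hrpos.le)
    simp only [Set.mem_ofPred_eq, sub_self, norm_zero] at h1
    have h2 := hHle y hy
    have h3 : b * ‖y - x₀‖ ^ 2 < b * r ^ 2 := by
      have : 0 < b * r ^ 2 := by positivity
      linarith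
    exact lt_of_pow_lt_pow_left₀ 2 hrpos.le (lt_of_mul_lt_mul_left h3 hbpos.le)
  have hloc : IsLocalMax (fun z => H z - b * ‖z - x₀‖ ^ 2) y :=
    hymax.isLocalMax (mem_of_superset (Metric.isOpen_ball.mem_nhds
      (by rwa [Metric.mem_ball, dist_eq_norm])) Metric.ball_subset_closedBall)
  linarith [lap_le_of_isLocalMax_sub_norm_sq hHd hloc, hlap y hy]
end
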